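/- arXiv:1109.0168 — 7 statements merged into one kernel-verified Lean document; each statement's English description precedes it below -/
import Mathlib

section
/- Let p ≥ 1, let α := (5+√105)²/40, c := 2(α²/5 + 1), and let 0 ≤ λ < α^{−1}. Then there exists a constant C_p > 0, depending only on p, such that for every natural number N ≥ 1 and every family {ψ_1, …, ψ_N} of real-valued functions in C_c^∞(ℝ²) that is orthonormal in L²(ℝ²), one has Σ_{j=1}^N ∫_{ℝ²} ( |∇ψ_j(x,y)|² + (|xy|^p − λ(x²+y²)^{p/(p+2)}) ψ_j(x,y)² ) dx dy ≥ C_p (1 − αλ) N^{(2p+1)/(p+1)} / ((ln N)^p + 1)^{1/(p+1)} − cλN. -/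
open MeasureTheory Real

/-- The derivative of `t ↦ 7.2 t / (16 + t²)` minus its square. -/
noncomputable def hardyWeight (t : ℝ) : ℝ := (115.2 - 59.04 * t ^ 2) / (16 + t ^ 2) ^ 2

lemma continuous_hardyWeight : Continuous hardyWeight := by
  unfold hardyWeight
  refine Continuous.div (by fun_prop) (by fun_prop) fun t => by positivity

lemma hardyWeight_of_abs_le_one {t : ℝ} (ht : |t| ≤ 1) : 0.19 ≤ hardyWeight t := by
  have h1 : t ^ 2 ≤ 1 := (sq_le_one_iff_abs_le_one t).2 ht
  unfold hardyWeight
  rw [le_div_iff₀ (by positivity)]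
  nlinarith [sq_nonneg t]

lemma neg_le_hardyWeight (t : ℝ) : -0.9 ≤ hardyWeight t := by
  unfold hardyWeight
  rw [le_div_iff₀ (by positivity)]
  nlinarith [sq_nonneg t, sq_nonneg (t ^ 2 - 16)]

lemma le_hardyWeight_add_of_one_le {r : ℝ} (hr : 1 ≤ r) : 0.19 ≤ hardyWeight r + r / 2 := by
  have h : 0.19 - r / 2 ≤ hardyWeight r := by
    unfold hardyWeight
    rw [le_div_iff₀ (by positivity)]
    obtain ⟨d, rfl⟩ : ∃ d, r = 1 + d := ⟨r - 1, by ring⟩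
    have hd : 0 ≤ d := by linarith
    have h2 := pow_nonneg hd 2
    have h3 := pow_nonneg hd 3
    have h4 := pow_nonneg hd 4
    have h5 := pow_nonneg hd 5
    nlinarith
  linarith

lemma hardyWeight_abs (t : ℝ) : hardyWeight |t| = hardyWeight t := by
  simp [hardyWeight]

/-- A one-dimensional Hardy-type inequality. -/
lemma integral_hardyWeight_mul_sq_le {u u' : ℝ → ℝ} (hu : Continuous u) (hu' : Continuous u')
    (hs : HasCompactSupport u) (hs' : HasCompactSupport u') (hd : ∀ t, HasDerivAt u (u' t) t)
    (b : ℝ) : ∫ t, b ^ 2 * hardyWeight (b * t) * u t ^ 2 ≤ ∫ t, u' t ^ 2 := by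
  set F : ℝ → ℝ := fun t => b * (7.2 * (b * t) / (16 + (b * t) ^ 2)) with hF
  set F' : ℝ → ℝ := fun t => b ^ 2 * (7.2 * (16 - (b * t) ^ 2) / (16 + (b * t) ^ 2) ^ 2) with hF'
  have hpos : ∀ t : ℝ, (16 + (b * t) ^ 2) ≠ 0 := fun t => by positivity
  have hFc : Continuous F :=
    continuous_const.mul (Continuous.div (by fun_prop) (by fun_prop) hpos)
  have hFc' : Continuous F' :=
    continuous_const.mul (Continuous.div (by fun_prop) (by fun_prop) fun t => pow_ne_zero _ (hpos t))
  have hFd : ∀ t, HasDerivAt F (F' t) t := by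
    intro t
    have h1 : HasDerivAt (fun t : ℝ => b * t) b t := by simpa using (hasDerivAt_id t).const_mul b
    have h2 := ((h1.const_mul 7.2).div ((h1.pow 2).const_add 16) (hpos t)).const_mul b
    refine h2.congr_deriv ?_
    simp only [hF', Pi.pow_apply]
    have := hpos t
    field_simp
    ring
  have hq : ∀ t, b ^ 2 * hardyWeight (b * t) = F' t - F t ^ 2 := by
    intro t
    have := hpos t
    simp only [hF, hF', hardyWeight]
    field_simp
    ring
  have hder : ∀ t, HasDerivAt (fun t => F t * u t ^ 2)
      (F' t * u t ^ 2 + F t * (2 * u t * u' t)) t := by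
    intro t
    have := (hFd t).mul ((hd t).pow 2)
    simpa using! this
  have i1 : Integrable (fun t => F' t * u t ^ 2 + F t * (2 * u t * u' t)) := by
    apply Continuous.integrable_of_hasCompactSupport (by fun_prop)
    have e : (fun t => F' t * u t ^ 2 + F t * (2 * u t * u' t))
        = fun t => (F' t * u t + F t * (2 * u' t)) * u t := by ext; ring
    rw [e]; exact hs.mul_left
  have i2 : Integrable (fun t => F t * u t ^ 2) := by
    apply Continuous.integrable_of_hasCompactSupport (by fun_prop)
    have e : (fun t => F t * u t ^ 2) = fun t => (F t * u t) * u t := by ext; ring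
    rw [e]; exact hs.mul_left
  have i3 : Integrable (fun t => u' t ^ 2) := by
    apply Continuous.integrable_of_hasCompactSupport (by fun_prop)
    have e : (fun t => u' t ^ 2) = fun t => u' t * u' t := by ext; ring
    rw [e]; exact hs'.mul_left
  have i4 : Integrable (fun t => b ^ 2 * hardyWeight (b * t) * u t ^ 2) := by
    have := continuous_hardyWeight
    apply Continuous.integrable_of_hasCompactSupport (by fun_prop)
    have e : (fun t => b ^ 2 * hardyWeight (b * t) * u t ^ 2)
        = fun t => (b ^ 2 * hardyWeight (b * t) * u t) * u t := by ext; ring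
    rw [e]; exact hs.mul_left
  have h0 := integral_eq_zero_of_hasDerivAt_of_integrable hder i1 i2
  have h1 := integral_mono i4 (i3.add i1) (fun t => by
    simp only [Pi.add_apply, hq]
    nlinarith [sq_nonneg (u' t + F t * u t)])
  rw [integral_add' i3 i1, h0, add_zero] at h1
  exact h1

lemma HasCompactSupport.mul_sq {X : Type*} [TopologicalSpace X] {f : X → ℝ}
    (hf : HasCompactSupport f) (g : X → ℝ) : HasCompactSupport (fun v => g v * f v ^ 2) := by
  have e : (fun v => g v * f v ^ 2) = fun v => (g v * f v) * f v := by ext; ring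
  rw [e]; exact hf.mul_left

lemma integrable_mul_sq {f g : ℝ × ℝ → ℝ} (hg : Continuous g) (hf : Continuous f)
    (hs : HasCompactSupport f) : Integrable (fun v => g v * f v ^ 2) :=
  Continuous.integrable_of_hasCompactSupport (by fun_prop) (hs.mul_sq g)

lemma integrable_sq {f : ℝ × ℝ → ℝ} (hf : Continuous f)
    (hs : HasCompactSupport f) : Integrable (fun v => f v ^ 2) := by
  simpa using integrable_mul_sq (continuous_const (y := (1 : ℝ))) hf hs

lemma HasCompactSupport.slice_snd {f : ℝ × ℝ → ℝ} (hf : HasCompactSupport f) (x : ℝ) :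
    HasCompactSupport (fun y => f (x, y)) :=
  hf.comp_isClosedEmbedding <| Function.LeftInverse.isClosedEmbedding (f := Prod.snd) (fun _ => rfl) (by fun_prop)
    (by fun_prop)

lemma integral_hardyWeight_snd_le {f d : ℝ × ℝ → ℝ} (hf : Continuous f) (hd : Continuous d)
    (hs : HasCompactSupport f) (hs' : HasCompactSupport d)
    (hfd : ∀ x y, HasDerivAt (fun y => f (x, y)) (d (x, y)) y) {b : ℝ → ℝ} (hb : Continuous b) :
    ∫ v : ℝ × ℝ, b v.1 ^ 2 * hardyWeight (b v.1 * v.2) * f v ^ 2 ≤ ∫ v, d v ^ 2 := by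
  have := continuous_hardyWeight
  have i1 : Integrable (fun v : ℝ × ℝ => b v.1 ^ 2 * hardyWeight (b v.1 * v.2) * f v ^ 2) :=
    integrable_mul_sq (by fun_prop) hf hs
  have i2 := integrable_sq hd hs'
  rw [Measure.volume_eq_prod] at *
  rw [integral_prod _ i1, integral_prod _ i2]
  exact integral_mono i1.integral_prod_left i2.integral_prod_left fun x =>
    integral_hardyWeight_mul_sq_le (by fun_prop) (by fun_prop) (hs.slice_snd x) (hs'.slice_snd x)
      (hfd x) (b x)

lemma integral_hardyWeight_fst_le {f d : ℝ × ℝ → ℝ} (hf : Continuous f) (hd : Continuous d)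
    (hs : HasCompactSupport f) (hs' : HasCompactSupport d)
    (hfd : ∀ x y, HasDerivAt (fun x => f (x, y)) (d (x, y)) x) {b : ℝ → ℝ} (hb : Continuous b) :
    ∫ v : ℝ × ℝ, b v.2 ^ 2 * hardyWeight (b v.2 * v.1) * f v ^ 2 ≤ ∫ v, d v ^ 2 := by
  have h := integral_hardyWeight_snd_le (f := fun v => f v.swap) (d := fun v => d v.swap)
    (by fun_prop) (by fun_prop) (hs.comp_homeomorph (Homeomorph.prodComm ℝ ℝ))
    (hs'.comp_homeomorph (Homeomorph.prodComm ℝ ℝ)) (fun x y => hfd y x) hb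
  have e1 := integral_prod_swap (μ := volume) (ν := volume)
    (fun v : ℝ × ℝ => b v.2 ^ 2 * hardyWeight (b v.2 * v.1) * f v ^ 2)
  have e2 := integral_prod_swap (μ := volume) (ν := volume) (fun v : ℝ × ℝ => d v ^ 2)
  rw [Measure.volume_eq_prod] at *
  rw [← e1, ← e2]
  exact h

lemma sq_integral_le_measureReal_mul {X : Type*} [MeasurableSpace X] {μ : Measure X}
    [IsFiniteMeasure μ] {g : X → ℝ} (hg : Integrable g μ) (hg2 : Integrable (fun x => g x ^ 2) μ) :
    (∫ x, g x ∂μ) ^ 2 ≤ μ.real Set.univ * ∫ x, g x ^ 2 ∂μ := by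
  have h : ∀ t : ℝ, 0 ≤ μ.real Set.univ * (t * t) + (-2 * ∫ x, g x ∂μ) * t + ∫ x, g x ^ 2 ∂μ := by
    intro t
    have h0 : 0 ≤ ∫ x, (g x ^ 2 + (-2 * t) * g x + t * t) ∂μ :=
      integral_nonneg fun x => by
        have := sq_nonneg (g x - t)
        simp only [Pi.zero_apply]; linarith
    have h1 : Integrable (fun x => g x ^ 2 + (-2 * t) * g x) μ := hg2.add (hg.const_mul _)
    rw [integral_add h1 (integrable_const _), integral_add hg2 (hg.const_mul _), integral_const_mul, integral_const, smul_eq_mul] at h0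
    linarith
  have := discrim_le_zero h
  unfold discrim at this
  linarith

lemma sq_sub_le_mul_integral {u u' : ℝ → ℝ} (hu' : Continuous u')
    (hd : ∀ t, HasDerivAt u (u' t) t) {a l x y : ℝ} (hl : 0 ≤ l)
    (hx : x ∈ Set.Ico a (a + l)) (hy : y ∈ Set.Ico a (a + l)) :
    (u x - u y) ^ 2 ≤ l * ∫ t in Set.Ico a (a + l), u' t ^ 2 := by
  have h1 : ∫ t in y..x, u' t = u x - u y :=
    intervalIntegral.integral_eq_sub_of_hasDerivAt (fun t _ => hd t) (hu'.intervalIntegrable _ _)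
  have hi : ∀ {g : ℝ → ℝ}, Continuous g → IntegrableOn g (Set.Ico a (a + l)) := fun {g} hg =>
    (hg.continuousOn.integrableOn_Icc).mono_set Set.Ico_subset_Icc_self
  have h2 : |u x - u y| ≤ ∫ t in Set.Ico a (a + l), |u' t| := by
    rw [← h1]
    refine (intervalIntegral.norm_integral_le_integral_norm_uIoc (f := u')).trans ?_
    refine setIntegral_mono_set (f := fun t => |u' t|) (hi (by fun_prop)) (ae_of_all _ fun t => abs_nonneg _)
      (LE.le.eventuallyLE ?_)
    intro t ht
    rw [Set.mem_uIoc] at ht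
    rcases ht with ht | ht <;> constructor <;> linarith [hx.1, hx.2, hy.1, hy.2, ht.1, ht.2]
  have h3 := sq_integral_le_measureReal_mul (μ := volume.restrict (Set.Ico a (a + l)))
    (g := fun t => |u' t|) (hi (by fun_prop)) (hi (by fun_prop))
  simp only [sq_abs, measureReal_restrict_apply_univ, Real.volume_real_Ico] at h3
  rw [add_sub_cancel_left, max_eq_left hl] at h3
  refine le_trans ?_ h3
  rw [← sq_abs]
  gcongr

/-- The half-open square of side `l` with lower-left corner `(a, b)`. -/
def halfOpenSquare (l a b : ℝ) : Set (ℝ × ℝ) := Set.Ico a (a + l) ×ˢ Set.Ico b (b + l)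

lemma measurableSet_halfOpenSquare (l a b : ℝ) : MeasurableSet (halfOpenSquare l a b) :=
  measurableSet_Ico.prod measurableSet_Ico

lemma volume_real_halfOpenSquare {l : ℝ} (hl : 0 ≤ l) (a b : ℝ) :
    volume.real (halfOpenSquare l a b) = l ^ 2 := by
  rw [halfOpenSquare, Measure.volume_eq_prod, measureReal_prod_prod, Real.volume_real_Ico,
    Real.volume_real_Ico, add_sub_cancel_left, add_sub_cancel_left, max_eq_left hl, sq]

/-- The Poincaré inequality on a square. -/
lemma poincare_halfOpenSquare {f dx dy : ℝ × ℝ → ℝ} (hf : Continuous f) (hdx : Continuous dx)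
    (hdy : Continuous dy)
    (hfx : ∀ x y, HasDerivAt (fun x => f (x, y)) (dx (x, y)) x)
    (hfy : ∀ x y, HasDerivAt (fun y => f (x, y)) (dy (x, y)) y) {l : ℝ} (hl : 0 < l) (a b : ℝ) :
    l ^ 2 * (∫ v in halfOpenSquare l a b, f v ^ 2) - (∫ v in halfOpenSquare l a b, f v) ^ 2 ≤
      l ^ 4 * ∫ v in halfOpenSquare l a b, (dx v ^ 2 + dy v ^ 2) := by
  set μ : Measure ℝ := volume.restrict (Set.Ico a (a + l)) with hμ
  set ν : Measure ℝ := volume.restrict (Set.Ico b (b + l)) with hν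
  have hμr : μ.real Set.univ = l := by
    simp [hμ, hl.le]
  have hνr : ν.real Set.univ = l := by
    simp [hν, hl.le]
  have hQ : (volume : Measure (ℝ × ℝ)).restrict (halfOpenSquare l a b) = μ.prod ν := by
    rw [hμ, hν, Measure.prod_restrict]; rfl
  rw [hQ]
  have hint : ∀ {g : ℝ × ℝ → ℝ}, Continuous g → Integrable g (μ.prod ν) := fun {g} hg => by
    rw [← hQ]
    have : IntegrableOn g (Set.Icc a (a + l) ×ˢ Set.Icc b (b + l)) :=
      hg.continuousOn.integrableOn_compact (isCompact_Icc.prod isCompact_Icc)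
    exact this.mono_set (Set.prod_mono Set.Ico_subset_Icc_self Set.Ico_subset_Icc_self)
  have hae : ∀ᵐ v ∂μ.prod ν, v ∈ halfOpenSquare l a b := by
    rw [← hQ]; exact ae_restrict_mem (measurableSet_halfOpenSquare l a b)
  set A : ℝ → ℝ := fun y => ∫ x, dx (x, y) ^ 2 ∂μ with hA
  set B : ℝ → ℝ := fun x => ∫ y, dy (x, y) ^ 2 ∂ν with hB
  have hdx2 : Integrable (fun v => dx v ^ 2) (μ.prod ν) := hint (by fun_prop)
  have hdy2 : Integrable (fun v => dy v ^ 2) (μ.prod ν) := hint (by fun_prop)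
  have hf1 : Integrable f (μ.prod ν) := hint hf
  have hf2 : Integrable (fun v => f v ^ 2) (μ.prod ν) := hint (by fun_prop)
  have hAi : Integrable (fun v : ℝ × ℝ => A v.2) (μ.prod ν) := hdx2.integral_prod_right.comp_snd μ
  have hBi : Integrable (fun v : ℝ × ℝ => B v.1) (μ.prod ν) := hdy2.integral_prod_left.comp_fst ν
  have hAe : ∫ v : ℝ × ℝ, A v.2 ∂μ.prod ν = l * ∫ v, dx v ^ 2 ∂μ.prod ν := by
    rw [integral_fun_snd A, hμr, integral_prod_symm _ hdx2, smul_eq_mul]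
  have hBe : ∫ v : ℝ × ℝ, B v.1 ∂μ.prod ν = l * ∫ v, dy v ^ 2 ∂μ.prod ν := by
    rw [integral_fun_fst B, hνr, integral_prod _ hdy2, smul_eq_mul]
  have hvol : (μ.prod ν).real Set.univ = l ^ 2 := by
    rw [← hQ, measureReal_restrict_apply_univ, volume_real_halfOpenSquare hl.le]
  have key : ∀ v ∈ halfOpenSquare l a b, ∀ w ∈ halfOpenSquare l a b,
      f v ^ 2 + (-2 * f v) * f w + f w ^ 2 ≤ 2 * l * A v.2 + 2 * l * B w.1 := by
    intro v hv w hw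
    have h1 := sq_sub_le_mul_integral (u := fun x => f (x, v.2)) (u' := fun x => dx (x, v.2))
      (by fun_prop) (fun x => hfx x v.2) hl.le hv.1 hw.1
    have h2 := sq_sub_le_mul_integral (u := fun y => f (w.1, y)) (u' := fun y => dy (w.1, y))
      (by fun_prop) (fun y => hfy w.1 y) hl.le hv.2 hw.2
    simp only [Prod.mk.eta] at h1 h2
    simp only [hA, hB]
    nlinarith [sq_nonneg ((f v - f (w.1, v.2)) - (f (w.1, v.2) - f w))]
  have step : ∀ v ∈ halfOpenSquare l a b,
      l ^ 2 * f v ^ 2 + (-2 * ∫ w, f w ∂μ.prod ν) * f v + ∫ w, f w ^ 2 ∂μ.prod ν ≤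
        2 * l ^ 3 * A v.2 + 2 * l ^ 2 * ∫ w, dy w ^ 2 ∂μ.prod ν := by
    intro v hv
    have h := integral_mono_ae
      (((integrable_const (f v ^ 2)).add (hf1.const_mul (-2 * f v))).add hf2)
      ((integrable_const (2 * l * A v.2)).add (hBi.const_mul (2 * l)))
      (hae.mono fun w hw => key v hv w hw)
    rw [integral_add' ((integrable_const (f v ^ 2)).add (hf1.const_mul (-2 * f v))) hf2,
      integral_add' (integrable_const (f v ^ 2)) (hf1.const_mul (-2 * f v)),
      integral_add' (integrable_const _) (hBi.const_mul (2 * l)), integral_const, integral_const,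
      integral_const_mul, integral_const_mul, hvol, hBe, smul_eq_mul, smul_eq_mul] at h
    linarith
  have h := integral_mono_ae
      (((hf2.const_mul (l ^ 2)).add (hf1.const_mul (-2 * ∫ w, f w ∂μ.prod ν))).add
        (integrable_const (∫ w, f w ^ 2 ∂μ.prod ν)))
      ((hAi.const_mul (2 * l ^ 3)).add
        (integrable_const (2 * l ^ 2 * ∫ w, dy w ^ 2 ∂μ.prod ν)))
      (hae.mono fun w hw => step w hw)
  rw [integral_add' ((hf2.const_mul (l ^ 2)).add (hf1.const_mul (-2 * ∫ w, f w ∂μ.prod ν)))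
      (integrable_const (∫ w, f w ^ 2 ∂μ.prod ν)),
    integral_add' (hf2.const_mul (l ^ 2)) (hf1.const_mul (-2 * ∫ w, f w ∂μ.prod ν)),
    integral_add' (hAi.const_mul (2 * l ^ 3)) (integrable_const _), integral_const, integral_const,
    integral_const_mul, integral_const_mul, integral_const_mul, hvol, hAe, smul_eq_mul,
    smul_eq_mul] at h
  rw [integral_add hdx2 hdy2]
  linarith

/-- The Bessel inequality for the pairing of an orthonormal family with the indicator of a set. -/
lemma sum_sq_setIntegral_le {X : Type*} [MeasurableSpace X] {μ : Measure X} {ι : Type*} [Fintype ι]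
    [DecidableEq ι] {ψ : ι → X → ℝ} (h1 : ∀ i, Integrable (ψ i) μ)
    (h2 : ∀ i j, Integrable (fun x => ψ i x * ψ j x) μ)
    (ho : ∀ i j, ∫ x, ψ i x * ψ j x ∂μ = if i = j then 1 else 0) {s : Set X}
    (hs : MeasurableSet s) (hfin : μ s ≠ ⊤) :
    ∑ i, (∫ x in s, ψ i x ∂μ) ^ 2 ≤ μ.real s := by
  set c : ι → ℝ := fun i => ∫ x in s, ψ i x ∂μ with hc
  have e : ∀ x, (s.indicator (fun _ => (1 : ℝ)) x - ∑ i, c i * ψ i x) ^ 2 =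
      s.indicator (fun _ => (1 : ℝ)) x - 2 * ∑ i, c i * s.indicator (ψ i) x
        + ∑ i, ∑ j, c i * c j * (ψ i x * ψ j x) := by
    intro x
    have e2 : (∑ i, c i * ψ i x) ^ 2 = ∑ i, ∑ j, c i * c j * (ψ i x * ψ j x) := by
      rw [sq, Finset.sum_mul_sum]
      exact Finset.sum_congr rfl fun i _ => Finset.sum_congr rfl fun j _ => by ring
    rw [sub_sq, e2]
    by_cases hx : x ∈ s <;> simp [hx]
  have i1 : Integrable (s.indicator (fun _ => (1 : ℝ))) μ :=
    (integrable_indicator_iff hs).2 (integrableOn_const hfin)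
  have i2 : ∀ i, Integrable (fun x => c i * s.indicator (ψ i) x) μ := fun i =>
    ((h1 i).indicator hs).const_mul _
  have i2' : Integrable (fun x => 2 * ∑ i, c i * s.indicator (ψ i) x) μ :=
    (integrable_finsetSum _ fun i _ => i2 i).const_mul 2
  have i3 : ∀ i j, Integrable (fun x => c i * c j * (ψ i x * ψ j x)) μ := fun i j =>
    (h2 i j).const_mul _
  have i3' : Integrable (fun x => ∑ i, ∑ j, c i * c j * (ψ i x * ψ j x)) μ :=
    integrable_finsetSum _ fun i _ => integrable_finsetSum _ fun j _ => i3 i j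
  have h0 : 0 ≤ ∫ x, (s.indicator (fun _ => (1 : ℝ)) x - ∑ i, c i * ψ i x) ^ 2 ∂μ :=
    integral_nonneg fun x => sq_nonneg _
  simp_rw [e] at h0
  have i12 : Integrable (fun x => s.indicator (fun _ => (1 : ℝ)) x
      - 2 * ∑ i, c i * s.indicator (ψ i) x) μ := i1.sub i2'
  rw [integral_add i12 i3', integral_sub i1 i2', integral_const_mul,
    integral_finsetSum _ fun i _ => i2 i,
    integral_finsetSum _ fun i _ => integrable_finsetSum _ fun j _ => i3 i j] at h0
  simp_rw [integral_finsetSum _ fun j _ => i3 _ j, integral_const_mul, ho,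
    integral_indicator hs] at h0
  simp only [mul_ite, mul_one, mul_zero, Finset.sum_ite_eq, Finset.mem_univ, if_true,
    integral_const, measureReal_restrict_apply_univ, smul_eq_mul] at h0
  have e3 : ∑ i, c i * c i = ∑ i, c i ^ 2 := Finset.sum_congr rfl fun i _ => by ring
  change 0 ≤ μ.real s - 2 * ∑ i, c i * c i + ∑ i, c i * c i at h0
  rw [e3] at h0
  linarith

/-- `f` is continuously differentiable and compactly supported, with partial derivatives `dx`
and `dy`. -/
structure HasCompactPartials (f dx dy : ℝ × ℝ → ℝ) : Prop where
  continuous : Continuous f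
  continuous_fst : Continuous dx
  continuous_snd : Continuous dy
  compact : HasCompactSupport f
  compact_fst : HasCompactSupport dx
  compact_snd : HasCompactSupport dy
  hasDerivAt_fst : ∀ x y, HasDerivAt (fun x => f (x, y)) (dx (x, y)) x
  hasDerivAt_snd : ∀ x y, HasDerivAt (fun y => f (x, y)) (dy (x, y)) y

/-- The cell of the square grid of mesh `l` with index `z`. -/
def gridCell (l : ℝ) (z : ℤ × ℤ) : Set (ℝ × ℝ) := halfOpenSquare l (z.1 * l) (z.2 * l)

lemma mem_gridCell_iff {l : ℝ} (hl : 0 < l) (z : ℤ × ℤ) (v : ℝ × ℝ) :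
    v ∈ gridCell l z ↔ (⌊v.1 / l⌋, ⌊v.2 / l⌋) = z := by
  have h : ∀ (x : ℝ) (m : ℤ), x ∈ Set.Ico (m * l) (m * l + l) ↔ ⌊x / l⌋ = m := by
    intro x m
    rw [Int.floor_eq_iff, le_div_iff₀ hl, div_lt_iff₀ hl, Set.mem_Ico, add_mul, one_mul]
  rw [gridCell, halfOpenSquare, Set.mem_prod, h, h, Prod.ext_iff]

/-- Off the cells of `S` the potential controls the `L²` mass, on the cells of `S` the Poincaré
inequality does. -/
lemma HasCompactPartials.integral_sq_sub_le {f dx dy : ℝ × ℝ → ℝ} (h : HasCompactPartials f dx dy)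
    {l : ℝ} (hl : 0 < l) (S : Finset (ℤ × ℤ)) {V : ℝ × ℝ → ℝ} (hV : Continuous V)
    (hV0 : ∀ v, 0 ≤ V v) (hVS : ∀ v : ℝ × ℝ, (⌊v.1 / l⌋, ⌊v.2 / l⌋) ∉ S → 1 ≤ l ^ 2 * V v) :
    (∫ v, f v ^ 2) - ∑ z ∈ S, (∫ v in gridCell l z, f v) ^ 2 / l ^ 2 ≤
      l ^ 2 * ∫ v, (dx v ^ 2 + dy v ^ 2 + V v * f v ^ 2) := by
  have iG : Integrable (fun v => dx v ^ 2 + dy v ^ 2) :=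
    (integrable_sq h.continuous_fst h.compact_fst).add
      (integrable_sq h.continuous_snd h.compact_snd)
  have iV : Integrable (fun v => V v * f v ^ 2) := integrable_mul_sq hV h.continuous h.compact
  have i2 : Integrable (fun v => f v ^ 2) := integrable_sq h.continuous h.compact
  set U : Set (ℝ × ℝ) := ⋃ z ∈ S, gridCell l z with hU
  have hm : ∀ z ∈ S, MeasurableSet (gridCell l z) := fun z _ => measurableSet_halfOpenSquare _ _ _
  have hUm : MeasurableSet U := Finset.measurableSet_biUnion _ hm
  have hdisj : (S : Set (ℤ × ℤ)).Pairwise (Function.onFun Disjoint (gridCell l)) := by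
    intro z _ w _ hzw
    rw [Function.onFun, Set.disjoint_left]
    intro v hv hw
    rw [mem_gridCell_iff hl] at hv hw
    exact hzw (hv.symm.trans hw)
  have hUc : ∀ v, v ∉ U → (⌊v.1 / l⌋, ⌊v.2 / l⌋) ∉ S := by
    intro v hv hS
    exact hv (Set.mem_biUnion hS ((mem_gridCell_iff hl _ _).2 rfl))
  have a1 : ∫ v in U, (dx v ^ 2 + dy v ^ 2) ≤ ∫ v, (dx v ^ 2 + dy v ^ 2) :=
    setIntegral_le_integral iG (ae_of_all _ fun v => by positivity)
  rw [integral_biUnion_finset S hm hdisj fun z _ => iG.integrableOn] at a1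
  have a2 : ∫ v in U, f v ^ 2 = ∑ z ∈ S, ∫ v in gridCell l z, f v ^ 2 :=
    integral_biUnion_finset S hm hdisj fun z _ => i2.integrableOn
  have a3 : ∑ z ∈ S, ((∫ v in gridCell l z, f v ^ 2) - (∫ v in gridCell l z, f v) ^ 2 / l ^ 2) ≤
      ∑ z ∈ S, l ^ 2 * ∫ v in gridCell l z, (dx v ^ 2 + dy v ^ 2) := by
    refine Finset.sum_le_sum fun z _ => ?_
    have hp := poincare_halfOpenSquare h.continuous h.continuous_fst h.continuous_snd
      h.hasDerivAt_fst h.hasDerivAt_snd hl (z.1 * l) (z.2 * l)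
    have hl2 : (0 : ℝ) < l ^ 2 := by positivity
    rw [← mul_le_mul_iff_right₀ hl2, mul_sub, mul_div_cancel₀ _ hl2.ne']
    simp only [gridCell]
    linarith
  rw [Finset.sum_sub_distrib, ← Finset.mul_sum, ← a2] at a3
  have a4 : ∫ v in Uᶜ, V v * f v ^ 2 ≤ ∫ v, V v * f v ^ 2 :=
    setIntegral_le_integral iV (ae_of_all _ fun v => mul_nonneg (hV0 v) (sq_nonneg _))
  have a5 : ∫ v in Uᶜ, f v ^ 2 ≤ ∫ v in Uᶜ, l ^ 2 * (V v * f v ^ 2) := by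
    refine setIntegral_mono_on i2.integrableOn (iV.const_mul _).integrableOn hUm.compl fun v hv => ?_
    nlinarith [hVS v (hUc v hv), sq_nonneg (f v)]
  rw [integral_const_mul] at a5
  have a6 := integral_add_compl hUm i2
  rw [integral_add iG iV]
  have hl2 : (0 : ℝ) ≤ l ^ 2 := by positivity
  nlinarith [mul_le_mul_of_nonneg_left a1 hl2, mul_le_mul_of_nonneg_left a4 hl2]

lemma sub_card_le_mul_sum_integral {N : ℕ} {f dx dy : Fin N → ℝ × ℝ → ℝ}
    (h : ∀ j, HasCompactPartials (f j) (dx j) (dy j))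
    (ho : ∀ i j, (∫ v, f i v * f j v) = if i = j then 1 else 0)
    {l : ℝ} (hl : 0 < l) (S : Finset (ℤ × ℤ)) {V : ℝ × ℝ → ℝ} (hV : Continuous V)
    (hV0 : ∀ v, 0 ≤ V v) (hVS : ∀ v : ℝ × ℝ, (⌊v.1 / l⌋, ⌊v.2 / l⌋) ∉ S → 1 ≤ l ^ 2 * V v) :
    (N : ℝ) - S.card ≤ l ^ 2 * ∑ j, ∫ v, (dx j v ^ 2 + dy j v ^ 2 + V v * f j v ^ 2) := by
  have h1 := Finset.sum_le_sum fun j (_ : j ∈ Finset.univ) =>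
    (h j).integral_sq_sub_le hl S hV hV0 hVS
  have h2 : ∀ j, ∫ v, f j v ^ 2 = 1 := fun j => by simpa [sq] using ho j j
  rw [← Finset.mul_sum, Finset.sum_sub_distrib, Finset.sum_comm] at h1
  simp only [h2, Finset.sum_const, Finset.card_univ, Fintype.card_fin, nsmul_eq_mul, mul_one] at h1
  have h3 : ∑ z ∈ S, ∑ j, (∫ v in gridCell l z, f j v) ^ 2 / l ^ 2 ≤ ∑ z ∈ S, 1 := by
    refine Finset.sum_le_sum fun z _ => ?_
    have hvol := volume_real_halfOpenSquare hl.le (z.1 * l) (z.2 * l)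
    have hb := sum_sq_setIntegral_le (μ := (volume : Measure (ℝ × ℝ)))
      (fun i => (h i).continuous.integrable_of_hasCompactSupport (h i).compact)
      (fun i j => ((h i).continuous.mul (h j).continuous).integrable_of_hasCompactSupport
        (h j).compact.mul_left) ho (measurableSet_halfOpenSquare l (z.1 * l) (z.2 * l)) (by
        intro htop
        rw [Measure.real, htop, ENNReal.toReal_top] at hvol
        have := pow_pos hl 2
        linarith)
    rw [hvol] at hb
    rw [← Finset.sum_div, div_le_one (by positivity)]
    exact hb
  simp only [Finset.sum_const, nsmul_eq_mul, mul_one] at h3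
  linarith

lemma exists_floor_div_eq {l : ℝ} (hl : 0 < l) (x : ℝ) :
    ∃ (s : Bool) (a : ℕ), ⌊x / l⌋ = (if s then (a : ℤ) else -(a + 1)) ∧ a * l ≤ |x| := by
  have h1 : (⌊x / l⌋ : ℝ) * l ≤ x := (le_div_iff₀ hl).1 (Int.floor_le _)
  have h2 : x < (⌊x / l⌋ + 1 : ℝ) * l := (div_lt_iff₀ hl).1 (Int.lt_floor_add_one _)
  rcases hm : ⌊x / l⌋ with a | a
  · refine ⟨true, a, by simp, ?_⟩
    rw [hm] at h1
    exact le_trans (by simpa using h1) (le_abs_self x)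
  · refine ⟨false, a, by simp [Int.negSucc_eq], ?_⟩
    rw [hm] at h2
    refine le_trans ?_ (neg_le_abs x)
    push_cast [Int.negSucc_eq] at h2
    linarith

/-- Counting the lattice points in the hyperbolic cross `a, b ≤ T`, `a b ≤ B`. -/
lemma exists_finset_nat_card_le {T B : ℝ} (hT : 0 ≤ T) (hB : 0 ≤ B) :
    ∃ P : Finset (ℕ × ℕ), (P.card : ℝ) ≤ 2 * T + 1 + B * (1 + log (max T 1)) ∧
      ∀ a b : ℕ, (a : ℝ) ≤ T → (b : ℝ) ≤ T → (a * b : ℝ) ≤ B → (a, b) ∈ P := by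
  set K := ⌊T⌋₊
  have hKT : (K : ℝ) ≤ T := Nat.floor_le hT
  refine ⟨(Finset.range (K + 1)).biUnion fun a =>
    (Finset.range ((if a = 0 then K else ⌊B / a⌋₊) + 1)).image (Prod.mk a), ?_, ?_⟩
  · have h1 : (((Finset.range (K + 1)).biUnion fun a =>
        (Finset.range ((if a = 0 then K else ⌊B / a⌋₊) + 1)).image (Prod.mk a)).card : ℝ) ≤
        ∑ a ∈ Finset.range (K + 1), (((if a = 0 then K else ⌊B / a⌋₊) + 1 : ℕ) : ℝ) := by
      rw [← Nat.cast_sum, Nat.cast_le]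
      refine Finset.card_biUnion_le.trans (Finset.sum_le_sum fun a _ => ?_)
      exact Finset.card_image_le.trans (by simp)
    refine h1.trans ?_
    rw [Finset.sum_range_succ']
    have h2 : ∑ a ∈ Finset.range K, (((if a + 1 = 0 then K else ⌊B / (a + 1 : ℕ)⌋₊) + 1 : ℕ) : ℝ) ≤
        ∑ a ∈ Finset.range K, (B * ((a : ℝ) + 1)⁻¹ + 1) := by
      refine Finset.sum_le_sum fun a _ => ?_
      have := Nat.floor_le (a := B / (a + 1 : ℕ)) (by positivity)
      simp only [Nat.add_eq_zero_iff, one_ne_zero, and_false, if_false]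
      push_cast at this ⊢
      rw [div_eq_mul_inv] at this ⊢
      linarith
    have h3 : ∑ a ∈ Finset.range K, ((a : ℝ) + 1)⁻¹ ≤ 1 + log (max T 1) := by
      have h := harmonic_le_one_add_log K
      have h4 : log K ≤ log (max T 1) := by
        rcases Nat.eq_zero_or_pos K with h0 | h0
        · rw [h0]; simpa using log_nonneg (le_max_right T 1)
        · exact log_le_log (by exact_mod_cast h0) (hKT.trans (le_max_left _ _))
      simp only [harmonic, Rat.cast_sum] at h
      push_cast at h
      linarith
    rw [Finset.sum_add_distrib, ← Finset.mul_sum] at h2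
    simp only [Finset.sum_const, Finset.card_range, nsmul_eq_mul, mul_one] at h2
    have h5 := mul_le_mul_of_nonneg_left h3 hB
    simp only [if_true]
    push_cast at h2 ⊢
    linarith
  · intro a b ha hb hab
    have ha' : a ≤ K := Nat.le_floor ha
    have hb' : b ≤ K := Nat.le_floor hb
    refine Finset.mem_biUnion.2 ⟨a, Finset.mem_range.2 (by lia), Finset.mem_image.2
      ⟨b, Finset.mem_range.2 ?_, rfl⟩⟩
    rw [Nat.lt_succ_iff]
    split_ifs with h0
    · exact hb'
    · refine Nat.le_floor ?_
      have : (0 : ℝ) < a := by exact_mod_cast Nat.pos_of_ne_zero h0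
      rw [le_div_iff₀ this]
      linarith

lemma exists_finset_int_card_le {T B : ℝ} (hT : 0 ≤ T) (hB : 0 ≤ B) :
    ∃ S : Finset (ℤ × ℤ), (S.card : ℝ) ≤ 4 * (2 * T + 1 + B * (1 + log (max T 1))) ∧
      ∀ l : ℝ, 0 < l → ∀ v : ℝ × ℝ, (⌊v.1 / l⌋, ⌊v.2 / l⌋) ∉ S →
        T * l ≤ |v.1| ∨ T * l ≤ |v.2| ∨ B * l ^ 2 ≤ |v.1 * v.2| := by
  obtain ⟨P, hP, hmem⟩ := exists_finset_nat_card_le hT hB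
  refine ⟨((Finset.univ : Finset (Bool × Bool)) ×ˢ P).image fun q =>
    ((if q.1.1 then (q.2.1 : ℤ) else -(q.2.1 + 1)), (if q.1.2 then (q.2.2 : ℤ) else -(q.2.2 + 1))),
    ?_, ?_⟩
  · have h : ((((Finset.univ : Finset (Bool × Bool)) ×ˢ P).image fun q : (Bool × Bool) × ℕ × ℕ =>
        ((if q.1.1 then (q.2.1 : ℤ) else -(q.2.1 + 1)),
          (if q.1.2 then (q.2.2 : ℤ) else -(q.2.2 + 1)))).card : ℝ) ≤ 4 * P.card := by
      have := Finset.card_image_le (s := (Finset.univ : Finset (Bool × Bool)) ×ˢ P)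
        (f := fun q : (Bool × Bool) × ℕ × ℕ => ((if q.1.1 then (q.2.1 : ℤ) else -(q.2.1 + 1)),
          (if q.1.2 then (q.2.2 : ℤ) else -(q.2.2 + 1))))
      rw [Finset.card_product] at this
      simp only [Finset.card_univ, Fintype.card_prod, Fintype.card_bool] at this
      exact_mod_cast this
    linarith
  · intro l hl v hv
    obtain ⟨s, a, e1, ha⟩ := exists_floor_div_eq hl v.1
    obtain ⟨t, b, e2, hb⟩ := exists_floor_div_eq hl v.2
    by_contra! hcon
    obtain ⟨c1, c2, c3⟩ := hcon
    have c3' : (a * l) * (b * l) < B * l ^ 2 := by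
      rw [abs_mul] at c3
      exact (mul_le_mul ha hb (by positivity) (abs_nonneg _)).trans_lt c3
    refine hv (Finset.mem_image.2 ⟨((s, t), (a, b)), Finset.mem_product.2
      ⟨Finset.mem_univ _, hmem a b ?_ ?_ ?_⟩, ?_⟩)
    · exact (lt_of_mul_lt_mul_right (ha.trans_lt c1) hl.le).le
    · exact (lt_of_mul_lt_mul_right (hb.trans_lt c2) hl.le).le
    · have hl2 : 0 < l ^ 2 := by positivity
      refine (lt_of_mul_lt_mul_right (a := l ^ 2) ?_ hl2.le).le
      linarith
    · rw [e1, e2]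

lemma HasCompactPartials.of_contDiff {f : ℝ × ℝ → ℝ} (hf : ContDiff ℝ (⊤ : ℕ∞) f)
    (hs : HasCompactSupport f) :
    HasCompactPartials f (fun v => fderiv ℝ f v (1, 0)) (fun v => fderiv ℝ f v (0, 1)) where
  continuous := hf.continuous
  continuous_fst := (hf.continuous_fderiv (by simp)).clm_apply continuous_const
  continuous_snd := (hf.continuous_fderiv (by simp)).clm_apply continuous_const
  compact := hs
  compact_fst := hs.fderiv_apply ℝ _
  compact_snd := hs.fderiv_apply ℝ _
  hasDerivAt_fst x y := ((hf.differentiable (by simp)) (x, y)).hasFDerivAt.comp_hasDerivAt x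
    ((hasDerivAt_id x).prodMk (hasDerivAt_const x y))
  hasDerivAt_snd x y := ((hf.differentiable (by simp)) (x, y)).hasFDerivAt.comp_hasDerivAt y
    ((hasDerivAt_const y x).prodMk (hasDerivAt_id y))

/-- The effective transverse frequency of the potential `|x y| ^ p` at distance `|x|` along a
cusp. -/
noncomputable def cuspFrequency (p x : ℝ) : ℝ := |x| ^ (p / (p + 2))

lemma continuous_cuspFrequency {p : ℝ} (hp : 1 ≤ p) : Continuous (cuspFrequency p) :=
  continuous_abs.rpow_const fun _ => Or.inr (by positivity)

lemma cuspFrequency_nonneg (p x : ℝ) : 0 ≤ cuspFrequency p x := rpow_nonneg (abs_nonneg x) _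

lemma continuous_abs_mul_rpow {p : ℝ} (hp : 1 ≤ p) :
    Continuous fun v : ℝ × ℝ => |v.1 * v.2| ^ p :=
  (continuous_fst.mul continuous_snd).abs.rpow_const fun _ => Or.inr (by positivity)

lemma cuspFrequency_sq_mul_rpow {p : ℝ} (hp : 1 ≤ p) (x y : ℝ) :
    cuspFrequency p x ^ 2 * |cuspFrequency p x * y| ^ p = |x * y| ^ p := by
  have h := cuspFrequency_nonneg p x
  rw [abs_mul, abs_mul, mul_rpow (abs_nonneg _) (abs_nonneg _),
    mul_rpow (abs_nonneg _) (abs_nonneg _), ← mul_assoc, abs_of_nonneg h, ← rpow_natCast,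
    ← rpow_add_of_nonneg h (by norm_num) (by linarith), cuspFrequency, ← rpow_mul (abs_nonneg x)]
  congr 2
  have : p + 2 ≠ 0 := by linarith
  push_cast
  field_simp
  ring

lemma le_cuspFrequency_sq_mul_hardyWeight {p : ℝ} (hp : 1 ≤ p) (x y : ℝ) :
    0.19 * cuspFrequency p x ^ 2 ≤
      cuspFrequency p x ^ 2 * hardyWeight (cuspFrequency p x * y) + |x * y| ^ p / 2 := by
  have h2 := sq_nonneg (cuspFrequency p x)
  rcases le_total |cuspFrequency p x * y| 1 with h | h
  · have h1 := hardyWeight_of_abs_le_one h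
    have h3 : 0 ≤ |x * y| ^ p := by positivity
    nlinarith
  · rw [← cuspFrequency_sq_mul_rpow hp x y]
    have h1 := le_hardyWeight_add_of_one_le h
    rw [hardyWeight_abs] at h1
    have h3 : |cuspFrequency p x * y| ≤ |cuspFrequency p x * y| ^ p := by
      simpa using rpow_le_rpow_of_exponent_le h hp
    nlinarith

lemma rpow_sq_add_sq_le {p : ℝ} (hp : 1 ≤ p) (x y : ℝ) :
    (x ^ 2 + y ^ 2) ^ (p / (p + 2)) ≤ cuspFrequency p x ^ 2 + cuspFrequency p y ^ 2 := by
  have h : ∀ t : ℝ, cuspFrequency p t ^ 2 = (t ^ 2) ^ (p / (p + 2)) := by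
    intro t
    rw [cuspFrequency, ← sq_abs t, ← rpow_natCast, ← rpow_natCast, ← rpow_mul (abs_nonneg t),
      ← rpow_mul (abs_nonneg t), mul_comm]
  rw [h, h]
  exact rpow_add_le_add_rpow (sq_nonneg x) (sq_nonneg y) (by positivity)
    ((div_le_one (by positivity)).2 (by linarith))

/-- The quadratic form of `-Δ + |x y| ^ p`, in terms of a function and its partial derivatives. -/
noncomputable def cuspEnergy (p : ℝ) (f dx dy : ℝ × ℝ → ℝ) : ℝ :=
  ∫ v : ℝ × ℝ, (dx v ^ 2 + dy v ^ 2 + |v.1 * v.2| ^ p * f v ^ 2)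

namespace HasCompactPartials

variable {f dx dy : ℝ × ℝ → ℝ}

lemma cuspEnergy_eq (h : HasCompactPartials f dx dy) {p : ℝ} (hp : 1 ≤ p) :
    cuspEnergy p f dx dy =
      (∫ v, dx v ^ 2) + (∫ v, dy v ^ 2) + ∫ v : ℝ × ℝ, |v.1 * v.2| ^ p * f v ^ 2 := by
  have i1 := integrable_sq h.continuous_fst h.compact_fst
  have i2 := integrable_sq h.continuous_snd h.compact_snd
  have i12 : Integrable (fun v => dx v ^ 2 + dy v ^ 2) := i1.add i2
  rw [cuspEnergy, integral_add i12
    (integrable_mul_sq (continuous_abs_mul_rpow hp) h.continuous h.compact), integral_add i1 i2]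

lemma integral_cuspFrequency_le (h : HasCompactPartials f dx dy) {p : ℝ} (hp : 1 ≤ p) :
    0.19 * ∫ v : ℝ × ℝ, (cuspFrequency p v.1 ^ 2 + cuspFrequency p v.2 ^ 2) * f v ^ 2 ≤
      cuspEnergy p f dx dy := by
  have hb := continuous_cuspFrequency hp
  have hq := continuous_hardyWeight
  have hp' := continuous_abs_mul_rpow hp
  have e1 := integral_hardyWeight_snd_le h.continuous h.continuous_snd h.compact h.compact_snd
    h.hasDerivAt_snd hb
  have e2 := integral_hardyWeight_fst_le h.continuous h.continuous_fst h.compact h.compact_fst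
    h.hasDerivAt_fst hb
  have i0 : Integrable (fun v : ℝ × ℝ => |v.1 * v.2| ^ p * f v ^ 2) :=
    integrable_mul_sq hp' h.continuous h.compact
  have i1 : Integrable (fun v : ℝ × ℝ =>
      cuspFrequency p v.1 ^ 2 * hardyWeight (cuspFrequency p v.1 * v.2) * f v ^ 2) :=
    integrable_mul_sq (by fun_prop) h.continuous h.compact
  have i2 : Integrable (fun v : ℝ × ℝ =>
      cuspFrequency p v.2 ^ 2 * hardyWeight (cuspFrequency p v.2 * v.1) * f v ^ 2) :=
    integrable_mul_sq (by fun_prop) h.continuous h.compact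
  have i3 : Integrable (fun v : ℝ × ℝ =>
      (cuspFrequency p v.1 ^ 2 + cuspFrequency p v.2 ^ 2) * f v ^ 2) :=
    integrable_mul_sq (by fun_prop) h.continuous h.compact
  have e3 := integral_mono (i3.const_mul 0.19) ((i2.add i1).add i0) (fun v => by
    have h1 := le_cuspFrequency_sq_mul_hardyWeight hp v.1 v.2
    have h2 := le_cuspFrequency_sq_mul_hardyWeight hp v.2 v.1
    rw [mul_comm v.2 v.1] at h2
    simp only [Pi.add_apply]
    nlinarith [mul_le_mul_of_nonneg_right (add_le_add h1 h2) (sq_nonneg (f v))])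
  rw [integral_const_mul, integral_add' (i2.add i1) i0, integral_add' i2 i1] at e3
  rw [h.cuspEnergy_eq hp]
  linarith

lemma integral_sq_le_cuspEnergy (h : HasCompactPartials f dx dy) {p : ℝ} (hp : 1 ≤ p) :
    0.015 * ∫ v, f v ^ 2 ≤ cuspEnergy p f dx dy := by
  have hb := continuous_cuspFrequency hp
  have hq := continuous_hardyWeight
  have e1 := integral_hardyWeight_fst_le h.continuous h.continuous_fst h.compact h.compact_fst
    h.hasDerivAt_fst (continuous_const (y := (0.4 : ℝ)))
  have e2 := h.integral_cuspFrequency_le hp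
  have i0 : Integrable (fun v => f v ^ 2) := integrable_sq h.continuous h.compact
  have i1 : Integrable (fun v : ℝ × ℝ => 0.4 ^ 2 * hardyWeight (0.4 * v.1) * f v ^ 2) :=
    integrable_mul_sq (by fun_prop) h.continuous h.compact
  have i2 : Integrable (fun v : ℝ × ℝ =>
      (cuspFrequency p v.1 ^ 2 + cuspFrequency p v.2 ^ 2) * f v ^ 2) :=
    integrable_mul_sq (by fun_prop) h.continuous h.compact
  have e3 := integral_mono (i0.const_mul 0.03) (i1.add (i2.const_mul 0.19)) (fun v => by
    have h1 : 0.03 ≤ 0.4 ^ 2 * hardyWeight (0.4 * v.1)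
        + 0.19 * (cuspFrequency p v.1 ^ 2 + cuspFrequency p v.2 ^ 2) := by
      rcases le_total |0.4 * v.1| 1 with h0 | h0
      · nlinarith [hardyWeight_of_abs_le_one h0, sq_nonneg (cuspFrequency p v.1),
          sq_nonneg (cuspFrequency p v.2)]
      · have h2 : 1 ≤ |v.1| := by
          rw [abs_mul, abs_of_pos (by norm_num : (0 : ℝ) < 0.4)] at h0
          linarith
        have h3 : 1 ≤ cuspFrequency p v.1 := one_le_rpow h2 (by positivity)
        nlinarith [neg_le_hardyWeight (0.4 * v.1), sq_nonneg (cuspFrequency p v.2)]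
    simp only [Pi.add_apply]
    nlinarith [mul_le_mul_of_nonneg_right h1 (sq_nonneg (f v))])
  rw [integral_const_mul, integral_add' i1 (i2.const_mul 0.19), integral_const_mul] at e3
  have e4 := h.cuspEnergy_eq hp
  have n1 : 0 ≤ ∫ v, dy v ^ 2 := integral_nonneg fun v => sq_nonneg _
  have n2 : 0 ≤ ∫ v : ℝ × ℝ, |v.1 * v.2| ^ p * f v ^ 2 := integral_nonneg fun v => by positivity
  linarith

lemma integral_add_le_two_mul_cuspEnergy (h : HasCompactPartials f dx dy) {p : ℝ} (hp : 1 ≤ p) :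
    ∫ v : ℝ × ℝ, (dx v ^ 2 + dy v ^ 2 + (|v.1 * v.2| ^ p
      + 0.19 * (cuspFrequency p v.1 ^ 2 + cuspFrequency p v.2 ^ 2)) * f v ^ 2) ≤
      2 * cuspEnergy p f dx dy := by
  have hb := continuous_cuspFrequency hp
  have i12 : Integrable (fun v => dx v ^ 2 + dy v ^ 2) :=
    (integrable_sq h.continuous_fst h.compact_fst).add
      (integrable_sq h.continuous_snd h.compact_snd)
  have i3 : Integrable (fun v : ℝ × ℝ => dx v ^ 2 + dy v ^ 2 + |v.1 * v.2| ^ p * f v ^ 2) :=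
    i12.add (integrable_mul_sq (continuous_abs_mul_rpow hp) h.continuous h.compact)
  have i4 : Integrable (fun v : ℝ × ℝ =>
      (cuspFrequency p v.1 ^ 2 + cuspFrequency p v.2 ^ 2) * f v ^ 2) :=
    integrable_mul_sq (by fun_prop) h.continuous h.compact
  have e : ∀ v : ℝ × ℝ, dx v ^ 2 + dy v ^ 2 + (|v.1 * v.2| ^ p
      + 0.19 * (cuspFrequency p v.1 ^ 2 + cuspFrequency p v.2 ^ 2)) * f v ^ 2 =
      (dx v ^ 2 + dy v ^ 2 + |v.1 * v.2| ^ p * f v ^ 2) +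
      0.19 * ((cuspFrequency p v.1 ^ 2 + cuspFrequency p v.2 ^ 2) * f v ^ 2) := fun v => by ring
  simp_rw [e]
  rw [integral_add i3 (i4.const_mul _), integral_const_mul]
  have := h.integral_cuspFrequency_le hp
  rw [cuspEnergy] at *
  linarith

/-- The weight `(x² + y²) ^ (p / (p + 2))` is form-bounded by `-Δ + |x y| ^ p`. -/
lemma one_sub_mul_cuspEnergy_le (h : HasCompactPartials f dx dy) {p : ℝ} (hp : 1 ≤ p)
    {α lam : ℝ} (hα : 5.5 ≤ α) (hlam : 0 ≤ lam) :
    (1 - α * lam) * cuspEnergy p f dx dy ≤ ∫ v : ℝ × ℝ, (dx v ^ 2 + dy v ^ 2 +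
      (|v.1 * v.2| ^ p - lam * (v.1 ^ 2 + v.2 ^ 2) ^ (p / (p + 2))) * f v ^ 2) := by
  have hb := continuous_cuspFrequency hp
  have hr : Continuous fun v : ℝ × ℝ => (v.1 ^ 2 + v.2 ^ 2) ^ (p / (p + 2)) :=
    Continuous.rpow_const (by fun_prop) fun _ => Or.inr (by positivity)
  have i12 : Integrable (fun v => dx v ^ 2 + dy v ^ 2) :=
    (integrable_sq h.continuous_fst h.compact_fst).add
      (integrable_sq h.continuous_snd h.compact_snd)
  have i3 : Integrable (fun v : ℝ × ℝ => dx v ^ 2 + dy v ^ 2 + |v.1 * v.2| ^ p * f v ^ 2) :=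
    i12.add (integrable_mul_sq (continuous_abs_mul_rpow hp) h.continuous h.compact)
  have i4 : Integrable (fun v : ℝ × ℝ => (v.1 ^ 2 + v.2 ^ 2) ^ (p / (p + 2)) * f v ^ 2) :=
    integrable_mul_sq hr h.continuous h.compact
  have i5 : Integrable (fun v : ℝ × ℝ =>
      (cuspFrequency p v.1 ^ 2 + cuspFrequency p v.2 ^ 2) * f v ^ 2) :=
    integrable_mul_sq (by fun_prop) h.continuous h.compact
  have e : ∀ v : ℝ × ℝ, dx v ^ 2 + dy v ^ 2 +
      (|v.1 * v.2| ^ p - lam * (v.1 ^ 2 + v.2 ^ 2) ^ (p / (p + 2))) * f v ^ 2 =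
      (dx v ^ 2 + dy v ^ 2 + |v.1 * v.2| ^ p * f v ^ 2) -
      lam * ((v.1 ^ 2 + v.2 ^ 2) ^ (p / (p + 2)) * f v ^ 2) := fun v => by ring
  simp_rw [e]
  rw [integral_sub i3 (i4.const_mul _), integral_const_mul, ← cuspEnergy]
  have h1 := integral_mono i4 i5 fun v =>
    mul_le_mul_of_nonneg_right (rpow_sq_add_sq_le hp v.1 v.2) (sq_nonneg (f v))
  have h2 := h.integral_cuspFrequency_le hp
  have h3 : 0 ≤ cuspEnergy p f dx dy := integral_nonneg fun v => by positivity
  have h4 : ∫ v : ℝ × ℝ, (v.1 ^ 2 + v.2 ^ 2) ^ (p / (p + 2)) * f v ^ 2 ≤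
      α * cuspEnergy p f dx dy := by nlinarith
  nlinarith [mul_le_mul_of_nonneg_left h4 hlam]

end HasCompactPartials

lemma one_le_sq_mul_of_le_abs {p l t : ℝ} (hp : 1 ≤ p) (hl : 0 < l)
    (ht : 27 * l ^ (-(2 * (p + 1) / p)) * l ≤ |t|) :
    1 ≤ l ^ 2 * (0.19 * cuspFrequency p t ^ 2) := by
  have hp2 : (0 : ℝ) < p + 2 := by linarith
  have hp0 : p ≠ 0 := by linarith
  have h1 : (27 : ℝ) ^ (p / (p + 2)) * l⁻¹ ≤ cuspFrequency p t := by
    have e : (27 * l ^ (-(2 * (p + 1) / p)) * l) ^ (p / (p + 2)) =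
        (27 : ℝ) ^ (p / (p + 2)) * l⁻¹ := by
      rw [mul_assoc, ← rpow_add_one hl.ne', mul_rpow (by norm_num) (by positivity),
        ← rpow_mul hl.le, ← rpow_neg_one l]
      congr 2
      field_simp
      ring
    rw [← e]
    exact rpow_le_rpow (by positivity) ht (by positivity)
  have h2 : (3 : ℝ) ≤ 27 ^ (p / (p + 2)) := by
    calc (3 : ℝ) = 27 ^ (1 / 3 : ℝ) := by
          rw [show (27 : ℝ) = 3 ^ (3 : ℝ) by norm_num, ← rpow_mul (by norm_num)]
          norm_num
      _ ≤ 27 ^ (p / (p + 2)) := by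
          refine rpow_le_rpow_of_exponent_le (by norm_num) ?_
          rw [div_le_div_iff₀ (by norm_num) hp2]
          linarith
  have h3 : 3 ≤ l * cuspFrequency p t := by
    have h4 : 3 * l⁻¹ ≤ cuspFrequency p t :=
      (mul_le_mul_of_nonneg_right h2 (by positivity)).trans h1
    rwa [← div_eq_mul_inv, div_le_iff₀ hl, mul_comm] at h4
  nlinarith

lemma one_le_sq_mul_of_le_abs_mul {p l t : ℝ} (hp : 1 ≤ p) (hl : 0 < l)
    (ht : l ^ (-(2 * (p + 1) / p)) * l ^ 2 ≤ |t|) : 1 ≤ l ^ 2 * |t| ^ p := by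
  have hp0 : p ≠ 0 := by linarith
  have e : (l ^ (-(2 * (p + 1) / p)) * l ^ 2) ^ p = (l ^ 2)⁻¹ := by
    rw [← rpow_natCast l 2, ← rpow_add hl, ← rpow_mul hl.le, ← rpow_neg hl.le]
    congr 1
    push_cast
    field_simp
    ring
  have h := rpow_le_rpow (by positivity) ht (by linarith : 0 ≤ p)
  rw [e] at h
  calc (1 : ℝ) = l ^ 2 * (l ^ 2)⁻¹ := (mul_inv_cancel₀ (by positivity)).symm
    _ ≤ _ := by gcongr

lemma sub_le_mul_sum_cuspEnergy {p l X : ℝ} (hp : 1 ≤ p) (hl : 0 < l)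
    (hX : X = l ^ (-(2 * (p + 1) / p))) {N : ℕ} {f dx dy : Fin N → ℝ × ℝ → ℝ}
    (h : ∀ j, HasCompactPartials (f j) (dx j) (dy j))
    (ho : ∀ i j, (∫ v, f i v * f j v) = if i = j then 1 else 0) :
    (N : ℝ) - 4 * (2 * (27 * X) + 1 + X * (1 + log (max (27 * X) 1))) ≤
      2 * l ^ 2 * ∑ j, cuspEnergy p (f j) (dx j) (dy j) := by
  have hb := continuous_cuspFrequency hp
  have hp' := continuous_abs_mul_rpow hp
  have hX0 : 0 ≤ X := by rw [hX]; positivity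
  obtain ⟨S, hS, hSv⟩ := exists_finset_int_card_le (T := 27 * X) (B := X) (by positivity) hX0
  have hmain := sub_card_le_mul_sum_integral h ho hl S
    (V := fun v => |v.1 * v.2| ^ p
      + 0.19 * (cuspFrequency p v.1 ^ 2 + cuspFrequency p v.2 ^ 2)) (by fun_prop)
    (fun v => by positivity) (fun v hv => by
      have hl2 : 0 ≤ l ^ 2 := by positivity
      have n1 : 0 ≤ l ^ 2 * |v.1 * v.2| ^ p := by positivity
      have n2 : 0 ≤ l ^ 2 * (0.19 * cuspFrequency p v.1 ^ 2) := by positivity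
      have n3 : 0 ≤ l ^ 2 * (0.19 * cuspFrequency p v.2 ^ 2) := by positivity
      have hv' := hSv l hl v hv
      rw [hX] at hv'
      rcases hv' with h1 | h1 | h1
      · linarith [one_le_sq_mul_of_le_abs hp hl h1]
      · linarith [one_le_sq_mul_of_le_abs hp hl h1]
      · linarith [one_le_sq_mul_of_le_abs_mul hp hl h1])
  have hsum := Finset.sum_le_sum fun j (_ : j ∈ Finset.univ) =>
    (h j).integral_add_le_two_mul_cuspEnergy hp
  rw [← Finset.mul_sum] at hsum
  have := mul_le_mul_of_nonneg_left hsum (sq_nonneg l)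
  linarith

lemma mul_rpow_div_le_sum_cuspEnergy {p : ℝ} (hp : 1 ≤ p) {N : ℕ} (hN : 1 ≤ N)
    {f dx dy : Fin N → ℝ × ℝ → ℝ} (h : ∀ j, HasCompactPartials (f j) (dx j) (dy j))
    (ho : ∀ i j, (∫ v, f i v * f j v) = if i = j then 1 else 0) :
    1 / 4000 * (N : ℝ) ^ ((2 * p + 1) / (p + 1)) / (log N ^ p + 1) ^ (1 / (p + 1)) ≤
      ∑ j, cuspEnergy p (f j) (dx j) (dy j) := by
  have hp0 : 0 < p := by linarith
  have hp1 : 0 < p + 1 := by linarith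
  have hN1 : (1 : ℝ) ≤ N := by exact_mod_cast hN
  have hN0 : (0 : ℝ) < N := by linarith
  have hlog : 0 ≤ log N := log_nonneg hN1
  have hM1 : 1 ≤ log N ^ p + 1 := by
    have : 0 ≤ log N ^ p := by positivity
    linarith
  set M := log N ^ p + 1 with hM
  have hM0 : 0 < M := by linarith
  have hNsplit : (N : ℝ) ^ ((2 * p + 1) / (p + 1)) = N * (N : ℝ) ^ (p / (p + 1)) := by
    nth_rewrite 2 [← rpow_one (N : ℝ)]
    rw [← rpow_add hN0]
    congr 1
    field_simp
    ring
  rcases le_or_gt 16 N with hN16 | hN16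
  · have hN16' : (16 : ℝ) ≤ N := by exact_mod_cast hN16
    set D := M ^ (1 / p) with hD
    have hD1 : 1 ≤ D := one_le_rpow hM1 (by positivity)
    have hDlog : log N ≤ D := by
      calc log N = (log N ^ p) ^ (1 / p) := by
            rw [← rpow_mul hlog, mul_one_div_cancel hp0.ne', rpow_one]
        _ ≤ D := rpow_le_rpow (by positivity) (by linarith) (by positivity)
    have hD0 : 0 < D := by linarith
    set X := 1 / 1000 * N / D with hXdef
    have hX0 : 0 < X := by positivity
    have hXD : X * D = 1 / 1000 * N := div_mul_cancel₀ _ hD0.ne'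
    have hXN : X ≤ 1 / 1000 * N := by nlinarith
    have hXlog : X * log N ≤ 1 / 1000 * N := by nlinarith
    set l := X ^ (-(p / (2 * (p + 1)))) with hl
    have hl0 : 0 < l := by positivity
    have hXl : X = l ^ (-(2 * (p + 1) / p)) := by
      rw [hl, ← rpow_mul hX0.le]
      nth_rewrite 1 [← rpow_one X]
      congr 1
      field_simp
    have hl2 : l ^ 2 = (X ^ (p / (p + 1)))⁻¹ := by
      rw [hl, ← rpow_natCast, ← rpow_mul hX0.le, ← rpow_neg hX0.le]
      congr 1
      push_cast
      field_simp
    have hmain := sub_le_mul_sum_cuspEnergy hp hl0 hXl h ho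
    have hlog2 : log (max (27 * X) 1) ≤ log N :=
      log_le_log (by positivity) (max_le (by linarith) hN1)
    have hhalf : (N : ℝ) / 2 ≤ 2 * l ^ 2 * ∑ j, cuspEnergy p (f j) (dx j) (dy j) := by
      nlinarith [mul_le_mul_of_nonneg_left hlog2 hX0.le]
    have hXp : 0 < X ^ (p / (p + 1)) := by positivity
    have h4 : N * X ^ (p / (p + 1)) / 4 ≤ ∑ j, cuspEnergy p (f j) (dx j) (dy j) := by
      rw [hl2, mul_assoc, ← div_le_iff₀' (by norm_num), le_inv_mul_iff₀ hXp] at hhalf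
      linarith
    refine le_trans ?_ h4
    have hXp' : X ^ (p / (p + 1)) =
        (1 / 1000) ^ (p / (p + 1)) * (N : ℝ) ^ (p / (p + 1)) / M ^ (1 / (p + 1)) := by
      rw [hXdef, div_rpow (by positivity) hD0.le, mul_rpow (by norm_num) hN0.le, hD,
        ← rpow_mul hM0.le]
      congr 2
      field_simp
    have hc : (1 / 1000 : ℝ) ≤ (1 / 1000) ^ (p / (p + 1)) := by
      nth_rewrite 1 [← rpow_one (1 / 1000 : ℝ)]
      exact rpow_le_rpow_of_exponent_ge (by norm_num) (by norm_num)
        ((div_le_one hp1).2 (by linarith))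
    rw [hXp', hNsplit]
    have hR : 0 ≤ N * (N : ℝ) ^ (p / (p + 1)) / M ^ (1 / (p + 1)) := by positivity
    calc 1 / 4000 * (N * (N : ℝ) ^ (p / (p + 1))) / M ^ (1 / (p + 1))
        = 1 / 1000 * (N * (N : ℝ) ^ (p / (p + 1)) / M ^ (1 / (p + 1))) / 4 := by ring
      _ ≤ (1 / 1000) ^ (p / (p + 1)) * (N * (N : ℝ) ^ (p / (p + 1)) / M ^ (1 / (p + 1))) / 4 := by
          gcongr
      _ = _ := by ring
  · have hN16' : (N : ℝ) ≤ 16 := by exact_mod_cast hN16.le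
    have h1 : 0.015 * N ≤ ∑ j, cuspEnergy p (f j) (dx j) (dy j) := by
      have h2 := Finset.sum_le_sum fun j (_ : j ∈ Finset.univ) =>
        (h j).integral_sq_le_cuspEnergy hp
      have h3 : ∀ j, ∫ v, f j v ^ 2 = 1 := fun j => by simpa [sq] using ho j j
      simp only [h3, Finset.sum_const, Finset.card_univ, Fintype.card_fin, nsmul_eq_mul] at h2
      linarith
    refine le_trans ?_ h1
    have h5 : (N : ℝ) ^ (p / (p + 1)) ≤ N := by
      nth_rewrite 2 [← rpow_one (N : ℝ)]
      exact rpow_le_rpow_of_exponent_le hN1 ((div_le_one hp1).2 (by linarith))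
    refine (div_le_self (by positivity) (one_le_rpow hM1 (by positivity))).trans ?_
    rw [hNsplit]
    nlinarith

/-- lower bound for sums of the quadratic form of `L_p(λ)` over orthonormal
families, equivalent to the eigenvalue-sum lower bound of Theorem 3.1; the constant `C`
depends only on `p`. -/
theorem eigenvalue_sum_lower_bound (p : ℝ) (hp : 1 ≤ p)
    (α c : ℝ) (hα : α = (5 + Real.sqrt 105) ^ 2 / 40) (hc : c = 2 * (α ^ 2 / 5 + 1)) :
    ∃ C : ℝ, 0 < C ∧ ∀ lam : ℝ, 0 ≤ lam → lam < α⁻¹ →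
      ∀ (N : ℕ), 1 ≤ N → ∀ ψ : Fin N → ℝ × ℝ → ℝ,
      (∀ j, ContDiff ℝ (⊤ : ℕ∞) (ψ j)) → (∀ j, HasCompactSupport (ψ j)) →
      (∀ i j : Fin N, (∫ v : ℝ × ℝ, ψ i v * ψ j v) = if i = j then 1 else 0) →
      (∑ j : Fin N, ∫ v : ℝ × ℝ,
          ((fderiv ℝ (ψ j) v (1, 0)) ^ 2 + (fderiv ℝ (ψ j) v (0, 1)) ^ 2 +
            (|v.1 * v.2| ^ p - lam * (v.1 ^ 2 + v.2 ^ 2) ^ (p / (p + 2))) * (ψ j v) ^ 2)) ≥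
        C * (1 - α * lam) * (N : ℝ) ^ ((2 * p + 1) / (p + 1)) /
          ((Real.log N) ^ p + 1) ^ (1 / (p + 1)) - c * lam * N := by
  have hα5 : 5.5 ≤ α := by
    have h10 : (10 : ℝ) ≤ √105 := le_sqrt_of_sq_le (by norm_num)
    rw [hα, le_div_iff₀ (by norm_num)]
    nlinarith
  refine ⟨1 / 4000, by norm_num, fun lam hlam hlam1 N hN ψ hψ hs ho => ?_⟩
  have h j := HasCompactPartials.of_contDiff (hψ j) (hs j)
  have h1 := Finset.sum_le_sum fun j (_ : j ∈ Finset.univ) =>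
    (h j).one_sub_mul_cuspEnergy_le hp hα5 hlam
  rw [← Finset.mul_sum] at h1
  have hα0 : 0 < α := by linarith
  have h2 : 0 ≤ 1 - α * lam := by
    have := mul_le_mul_of_nonneg_left hlam1.le hα0.le
    rw [mul_inv_cancel₀ hα0.ne'] at this
    linarith
  have h3 := mul_le_mul_of_nonneg_left (mul_rpow_div_le_sum_cuspEnergy hp hN h ho) h2
  have hc0 : 0 ≤ c * lam * N := by
    rw [hc]; positivity
  refine le_trans ?_ (h3.trans h1)
  refine (sub_le_self _ hc0).trans (le_of_eq ?_)
  ring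
end

section
/- Let p ≥ 1 and set Q(x,y) := |xy|^p + |x|^p + |y|^p + 1. There exists a constant C̃_p > 0, depending only on p, such that for every natural number N ≥ 1 there exists a family {ψ_1, …, ψ_N} of real-valued functions in C_c^∞(ℝ²), orthonormal in L²(ℝ²), with Σ_{j=1}^N ∫_{ℝ²} ( |∇ψ_j(x,y)|² + Q(x,y) ψ_j(x,y)² ) dx dy ≤ C̃_p N^{(2p+1)/(p+1)} / (1 + (ln N)^p)^{1/(p+1)}. -/
open MeasureTheory Real

/-- A smooth `L²`-normalized bump supported in the open square `(-1, 0)²`. -/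
lemma exists_normalized_bump_unit_square :
    ∃ φ : ℝ × ℝ → ℝ, ContDiff ℝ (⊤ : ℕ∞) φ ∧ HasCompactSupport φ ∧ (∫ v, φ v ^ 2) = 1 ∧
      ∀ v, φ v ≠ 0 → (-1 < v.1 ∧ v.1 < 0) ∧ (-1 < v.2 ∧ v.2 < 0) := by
  let f : ContDiffBump ((-(1 / 2), -(1 / 2)) : ℝ × ℝ) :=
    { rIn := 1 / 4, rOut := 1 / 2, rIn_pos := by norm_num, rIn_lt_rOut := by norm_num }
  have hcd : ContDiff ℝ (⊤ : ℕ∞) f := f.contDiff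
  have hcs : HasCompactSupport f := f.hasCompactSupport
  have hint : 0 < ∫ v, f v ^ 2 := by
    refine Continuous.integral_pos_of_hasCompactSupport_nonneg_nonzero
      (x := (-(1 / 2), -(1 / 2))) (hcd.continuous.pow 2) ?_ (fun v => sq_nonneg _) ?_
    · exact hcs.comp_left (g := fun t : ℝ => t ^ 2) (by simp)
    · rw [f.one_of_mem_closedBall (Metric.mem_closedBall_self f.rIn_pos.le)]
      norm_num
  set I := ∫ v, f v ^ 2 with hI
  refine ⟨fun v => (√I)⁻¹ * f v, contDiff_const.mul hcd, hcs.mul_left, ?_, ?_⟩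
  · simp_rw [mul_pow, inv_pow, Real.sq_sqrt hint.le]
    rw [integral_const_mul, ← hI, inv_mul_cancel₀ hint.ne']
  · intro v hv
    have hmem : v ∈ Function.support f := right_ne_zero_of_mul hv
    rw [f.support_eq, Metric.mem_ball, Prod.dist_eq, max_lt_iff, Real.dist_eq, Real.dist_eq,
      abs_lt, abs_lt] at hmem
    have h : f.rOut = 1 / 2 := rfl
    rw [h] at hmem
    obtain ⟨⟨h1, h2⟩, h3, h4⟩ := hmem
    dsimp only at h1 h2 h3 h4
    refine ⟨⟨?_, ?_⟩, ?_, ?_⟩ <;> linarith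

lemma integral_comp_smul_sub_plane (f : ℝ × ℝ → ℝ) {B : ℝ} (hB : 0 < B) (c : ℝ × ℝ) :
    ∫ v, f (B • v - c) = (B ^ 2)⁻¹ * ∫ v, f v := by
  rw [Measure.integral_comp_smul volume (fun w => f (w - c)) B, integral_sub_right_eq_self f c]
  have : Module.finrank ℝ (ℝ × ℝ) = 2 := by simp
  rw [this, abs_of_pos (by positivity), smul_eq_mul]

lemma HasCompactSupport.comp_smul_sub {φ : ℝ × ℝ → ℝ} (hφ : HasCompactSupport φ) {B : ℝ}
    (hB : B ≠ 0) (c : ℝ × ℝ) : HasCompactSupport fun v => φ (B • v - c) :=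
  hφ.comp_homeomorph ((Homeomorph.smulOfNeZero B hB).trans (Homeomorph.subRight c))

lemma fderiv_const_mul_comp_smul_sub {φ : ℝ × ℝ → ℝ} (hφ : Differentiable ℝ φ) (B : ℝ)
    (c v w : ℝ × ℝ) :
    fderiv ℝ (fun v => B * φ (B • v - c)) v w = B ^ 2 * fderiv ℝ φ (B • v - c) w := by
  have h1 : HasFDerivAt (fun v : ℝ × ℝ => B • v - c) (B • ContinuousLinearMap.id ℝ (ℝ × ℝ)) v :=
    ((hasFDerivAt_id v).const_smul B).sub_const c
  have h2 := (((hφ (B • v - c)).hasFDerivAt.comp v h1).const_mul B).fderiv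
  simp only [Function.comp_def] at h2
  rw [h2]
  simp
  ring

/-- The energy of a rescaled translate, when the potential is at most `M` on its support. -/
lemma integral_energy_rescaled_le {φ : ℝ × ℝ → ℝ} (hcd : ContDiff ℝ (⊤ : ℕ∞) φ)
    (hcs : HasCompactSupport φ) (hone : (∫ v, φ v ^ 2) = 1) {B : ℝ} (hB : 0 < B) (c : ℝ × ℝ)
    {Q : ℝ × ℝ → ℝ} {M : ℝ} (hQ0 : ∀ v, 0 ≤ Q v) (hQ : ∀ v, φ (B • v - c) ≠ 0 → Q v ≤ M) :
    (∫ v, ((fderiv ℝ (fun v => B * φ (B • v - c)) v (1, 0)) ^ 2 +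
        (fderiv ℝ (fun v => B * φ (B • v - c)) v (0, 1)) ^ 2 +
        Q v * (B * φ (B • v - c)) ^ 2)) ≤
      B ^ 2 * (∫ v, ((fderiv ℝ φ v (1, 0)) ^ 2 + (fderiv ℝ φ v (0, 1)) ^ 2)) + M := by
  have hd : Differentiable ℝ φ := hcd.differentiable (by simp)
  have hfd : Continuous (fderiv ℝ φ) := hcd.continuous_fderiv (by simp)
  set G : ℝ × ℝ → ℝ := fun v => (fderiv ℝ φ v (1, 0)) ^ 2 + (fderiv ℝ φ v (0, 1)) ^ 2 with hG
  have hGc : Continuous G := by fun_prop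
  have hGs : HasCompactSupport G :=
    (hcs.fderiv ℝ).comp_left
      (g := fun l : ℝ × ℝ →L[ℝ] ℝ => (l (1, 0)) ^ 2 + (l (0, 1)) ^ 2) (by simp)
  have hφc := hcd.continuous
  have hSs : HasCompactSupport fun v => φ v ^ 2 :=
    hcs.comp_left (g := fun t : ℝ => t ^ 2) (by simp)
  have i1 : Integrable fun v => G (B • v - c) :=
    Continuous.integrable_of_hasCompactSupport (by fun_prop) (hGs.comp_smul_sub hB.ne' c)
  have i2 : Integrable fun v => φ (B • v - c) ^ 2 :=
    Continuous.integrable_of_hasCompactSupport (by fun_prop) (hSs.comp_smul_sub hB.ne' c)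
  calc _ ≤ ∫ v, (B ^ 4 * G (B • v - c) + M * B ^ 2 * φ (B • v - c) ^ 2) := by
        refine integral_mono_of_nonneg (.of_forall fun v => ?_)
          ((i1.const_mul _).add (i2.const_mul _)) (.of_forall fun v => ?_)
        · have := hQ0 v
          dsimp only [Pi.zero_apply]
          positivity
        · dsimp only
          rw [fderiv_const_mul_comp_smul_sub hd, fderiv_const_mul_comp_smul_sub hd]
          have : Q v * (B * φ (B • v - c)) ^ 2 ≤ M * B ^ 2 * φ (B • v - c) ^ 2 := by
            by_cases h : φ (B • v - c) = 0
            · simp [h]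
            · rw [mul_pow, mul_assoc]
              exact mul_le_mul_of_nonneg_right (hQ v h) (by positivity)
          simp only [hG]
          linarith
    _ = _ := by
        rw [integral_add (i1.const_mul _) (i2.const_mul _), integral_const_mul,
          integral_const_mul, integral_comp_smul_sub_plane G hB,
          integral_comp_smul_sub_plane (fun v => φ v ^ 2) hB, hone]
        field_simp

lemma log_div_le_sum_Icc_inv {m n : ℕ} (hm : 1 ≤ m) (hmn : m ≤ n + 1) :
    log ((n + 1 : ℝ) / m) ≤ ∑ a ∈ Finset.Icc m n, (1 / a : ℝ) := by
  have hm0 : (0 : ℝ) < m := by exact_mod_cast hm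
  induction n, (show m - 1 ≤ n by omega) using Nat.le_induction with
  | base =>
    have : ((m - 1 : ℕ) : ℝ) + 1 = m := by
      rw [Nat.cast_sub hm]; simp
    rw [this, div_self hm0.ne', log_one]
    positivity
  | succ k hk ih =>
    rw [Finset.sum_Icc_succ_top (by omega)]
    have hk0 : (0 : ℝ) < (k : ℝ) + 1 := by positivity
    have h1 := ih (by omega)
    have h2 : log (((k : ℝ) + 1 + 1) / (k + 1)) ≤ 1 / ((k : ℝ) + 1) := by
      refine (log_le_sub_one_of_pos (by positivity)).trans (le_of_eq ?_)
      field_simp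
      ring
    rw [log_div (by positivity) (by positivity)] at h1 h2 ⊢
    push_cast
    linarith

/-- Many lattice points lie in the truncated hyperbolic region. -/
lemma exists_finset_hyperbolic {A B : ℝ} (hA : 2 ≤ A) (hB : 1 ≤ B) :
    ∃ S : Finset (ℕ × ℕ), (∀ q ∈ S, (1 ≤ q.1 ∧ (q.1 : ℝ) ≤ A * B) ∧
      (1 ≤ q.2 ∧ (q.2 : ℝ) ≤ A * B) ∧ (q.1 : ℝ) * q.2 ≤ A * B ^ 2) ∧ A * B ^ 2 / 2 * log (A / 2) ≤ S.card := by
  have hB0 : 0 < B := by linarith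
  have hA0 : 0 < A := by linarith
  set m := ⌈B⌉₊
  set n := ⌊A * B⌋₊
  have hBm : B ≤ m := Nat.le_ceil B
  have hm2 : (m : ℝ) ≤ 2 * B := by
    have := Nat.ceil_lt_add_one hB0.le
    linarith
  have hm : 1 ≤ m := Nat.one_le_ceil_iff.2 hB0
  have hm0 : (0 : ℝ) < m := by exact_mod_cast hm
  have hn : A * B < n + 1 := Nat.lt_floor_add_one _
  have hn' : (n : ℝ) ≤ A * B := Nat.floor_le (by positivity)
  have hmn : m ≤ n + 1 := by
    have : (m : ℝ) ≤ n + 1 := by nlinarith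
    exact_mod_cast this
  have key : ∀ a ∈ Finset.Icc m n, B ≤ a ∧ (a : ℝ) ≤ A * B := by
    intro a ha
    rw [Finset.mem_Icc] at ha
    exact ⟨hBm.trans (by exact_mod_cast ha.1), le_trans (by exact_mod_cast ha.2) hn'⟩
  refine ⟨((Finset.Icc m n).sigma fun a => Finset.Icc 1 ⌊A * B ^ 2 / a⌋₊).map
    (Equiv.sigmaEquivProd ℕ ℕ).toEmbedding, ?_, ?_⟩
  · intro q hq
    simp only [Finset.mem_map, Finset.mem_sigma] at hq
    obtain ⟨⟨a, b⟩, ⟨ha, hb⟩, rfl⟩ := hq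
    obtain ⟨h1, h2⟩ := key a ha
    have ha0 : (0 : ℝ) < a := by linarith
    have h3 : (b : ℝ) ≤ A * B ^ 2 / a :=
      (Nat.cast_le.2 (Finset.mem_Icc.1 hb).2).trans (Nat.floor_le (by positivity))
    rw [le_div_iff₀ ha0] at h3
    refine ⟨⟨hm.trans (Finset.mem_Icc.1 ha).1, h2⟩, ⟨(Finset.mem_Icc.1 hb).1, ?_⟩, ?_⟩
    · change (b : ℝ) ≤ A * B
      have hb0 : (0 : ℝ) ≤ b := b.cast_nonneg
      have : (b : ℝ) * B ≤ A * B * B := by nlinarith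
      exact le_of_mul_le_mul_right this hB0
    · change (a : ℝ) * b ≤ A * B ^ 2
      linarith
  · rw [Finset.card_map, Finset.card_sigma]
    simp only [Nat.card_Icc, Nat.add_sub_cancel]
    push_cast
    calc A * B ^ 2 / 2 * log (A / 2)
        ≤ A * B ^ 2 / 2 * log ((n + 1 : ℝ) / m) := by
          gcongr ?_ * ?_
          apply log_le_log (by positivity)
          rw [div_le_div_iff₀ (by norm_num) hm0]
          nlinarith
      _ ≤ A * B ^ 2 / 2 * ∑ a ∈ Finset.Icc m n, (1 / a : ℝ) := by
          gcongr
          exact log_div_le_sum_Icc_inv hm hmn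
      _ ≤ _ := by
          rw [Finset.mul_sum]
          refine Finset.sum_le_sum fun a ha => ?_
          obtain ⟨h1, h2⟩ := key a ha
          have ha0 : (0 : ℝ) < a := by linarith
          have h3 : 1 ≤ A * B ^ 2 / a := by
            rw [le_div_iff₀ ha0]
            nlinarith [mul_pos hA0 hB0]
          have h4 := Nat.lt_floor_add_one (A * B ^ 2 / a)
          have h5 : (1 : ℝ) ≤ (⌊A * B ^ 2 / a⌋₊ : ℝ) := by
            exact_mod_cast Nat.one_le_floor_iff _ |>.2 h3
          have h6 : A * B ^ 2 / 2 * (1 / a) = A * B ^ 2 / a / 2 := by ring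
          rw [h6]
          linarith

/-- Orthonormal families of `N` disjointly supported bumps of energy at most `C * A ^ p` each,
as soon as `N` is below the phase space volume `A ^ (p + 1) * log A`, up to constants. -/
lemma exists_orthonormal_family_energy_le {p : ℝ} (hp : 1 ≤ p) :
    ∃ K : ℝ, 0 < K ∧ ∀ (A : ℝ) (N : ℕ), 2 ≤ A → N ≤ A ^ (p + 1) / 2 * log (A / 2) →
      ∃ ψ : Fin N → ℝ × ℝ → ℝ,
        (∀ j, ContDiff ℝ (⊤ : ℕ∞) (ψ j)) ∧ (∀ j, HasCompactSupport (ψ j)) ∧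
        (∀ i j : Fin N, (∫ v : ℝ × ℝ, ψ i v * ψ j v) = if i = j then 1 else 0) ∧
        ∀ j : Fin N, (∫ v : ℝ × ℝ,
          ((fderiv ℝ (ψ j) v (1, 0)) ^ 2 + (fderiv ℝ (ψ j) v (0, 1)) ^ 2 +
            (|v.1 * v.2| ^ p + |v.1| ^ p + |v.2| ^ p + 1) * (ψ j v) ^ 2)) ≤ K * A ^ p := by
  obtain ⟨φ, hcd, hcs, hone, hsupp⟩ := exists_normalized_bump_unit_square
  have hK : 0 ≤ ∫ v, ((fderiv ℝ φ v (1, 0)) ^ 2 + (fderiv ℝ φ v (0, 1)) ^ 2) :=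
    integral_nonneg fun v => by positivity
  refine ⟨(∫ v, ((fderiv ℝ φ v (1, 0)) ^ 2 + (fderiv ℝ φ v (0, 1)) ^ 2)) + 4, by positivity,
    fun A N hA hN => ?_⟩
  have hA0 : 0 < A := by linarith
  set B := A ^ (p / 2) with hBdef
  have hB : 1 ≤ B := one_le_rpow (by linarith) (by linarith)
  have hB0 : 0 < B := by linarith
  have hB2 : B ^ 2 = A ^ p := by
    rw [hBdef, ← rpow_natCast, ← rpow_mul hA0.le]
    congr 1
    push_cast
    ring
  obtain ⟨S, hS, hcard⟩ := exists_finset_hyperbolic hA hB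
  have hAB : A * B ^ 2 = A ^ (p + 1) := by rw [hB2, rpow_add_one hA0.ne', mul_comm]
  have hNS : N ≤ S.card := by
    rw [hAB] at hcard
    exact_mod_cast hN.trans hcard
  obtain ⟨e⟩ : Nonempty (Fin N ↪ S) :=
    Function.Embedding.nonempty_of_card_le (by simpa using hNS)
  let c : Fin N → ℝ × ℝ := fun j => ((e j).1.1, (e j).1.2)
  refine ⟨fun j v => B * φ (B • v - c j), fun j => ?_, fun j => ?_, fun i j => ?_, fun j => ?_⟩
  · exact contDiff_const.mul (hcd.comp ((contDiff_const_smul B).sub contDiff_const))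
  · exact (hcs.comp_smul_sub hB0.ne' (c j)).mul_left
  · split_ifs with h
    · subst h
      have : ∀ v, B * φ (B • v - c i) * (B * φ (B • v - c i)) = B ^ 2 * φ (B • v - c i) ^ 2 :=
        fun v => by ring
      simp_rw [this]
      rw [integral_const_mul, integral_comp_smul_sub_plane (fun v => φ v ^ 2) hB0, hone]
      field_simp
    · rw [← integral_zero (ℝ × ℝ) ℝ]
      congr 1
      funext v
      by_contra hne
      obtain ⟨⟨h1, h2⟩, h3, h4⟩ := hsupp _ (right_ne_zero_of_mul (left_ne_zero_of_mul hne))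
      obtain ⟨⟨k1, k2⟩, k3, k4⟩ := hsupp _ (right_ne_zero_of_mul (right_ne_zero_of_mul hne))
      simp only [c, Prod.fst_sub, Prod.snd_sub] at h1 h2 h3 h4 k1 k2 k3 k4
      have aux : ∀ {a b : ℕ} {x : ℝ}, -1 < x - a → x - b < 0 → a ≤ b := by
        intro a b x hx hy
        have : (a : ℝ) < b + 1 := by linarith
        exact Nat.lt_succ_iff.1 (by exact_mod_cast this)
      refine h (e.injective (Subtype.ext (Prod.ext ?_ ?_)))
      · exact le_antisymm (aux h1 k2) (aux k1 h2)
      · exact le_antisymm (aux h3 k4) (aux k3 h4)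
  · have hp0 : 0 ≤ p := by linarith
    refine (integral_energy_rescaled_le hcd hcs hone hB0 (c j)
      (Q := fun v => |v.1 * v.2| ^ p + |v.1| ^ p + |v.2| ^ p + 1) (M := 4 * A ^ p)
      (fun v => by positivity) fun v hv => ?_).trans (le_of_eq ?_)
    · obtain ⟨⟨h1, h2⟩, h3, h4⟩ := hsupp _ hv
      obtain ⟨⟨q1, q1'⟩, ⟨q2, q2'⟩, q3⟩ := hS _ (e j).2
      simp only [c, Prod.fst_sub, Prod.snd_sub, Prod.smul_fst, Prod.smul_snd, smul_eq_mul]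
        at h1 h2 h3 h4
      have abs_mul_le : ∀ {n : ℕ} {x : ℝ}, 1 ≤ n → -1 < B * x - n → B * x - n < 0 →
          B * |x| ≤ n := by
        intro n x hn hx hx'
        have : (1 : ℝ) ≤ n := by exact_mod_cast hn
        rw [← abs_of_pos hB0, ← abs_mul, abs_le]
        constructor <;> linarith
      have b1 := abs_mul_le q1 h1 h2
      have b2 := abs_mul_le q2 h3 h4
      have hx : |v.1| ≤ A := by
        rw [mul_comm A] at q1'
        exact le_of_mul_le_mul_left (b1.trans q1') hB0
      have hy : |v.2| ≤ A := by
        rw [mul_comm A] at q2'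
        exact le_of_mul_le_mul_left (b2.trans q2') hB0
      have hxy : |v.1 * v.2| ≤ A := by
        rw [abs_mul]
        have := mul_le_mul b1 b2 (by positivity) (by positivity)
        refine le_of_mul_le_mul_left ?_ (pow_pos hB0 2)
        linarith
      have r1 := rpow_le_rpow (abs_nonneg _) hx hp0
      have r2 := rpow_le_rpow (abs_nonneg _) hy hp0
      have r3 := rpow_le_rpow (abs_nonneg _) hxy hp0
      have r4 : 1 ≤ A ^ p := one_le_rpow (by linarith) hp0
      linarith
    · rw [hB2]
      ring

/-- upper bound via trial orthonormal families for the operator `-Δ + Q`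
with `Q(x,y) = |xy|^p + |x|^p + |y|^p + 1` (Theorem 3.2 of the paper). -/
theorem eigenvalue_sum_upper_bound (p : ℝ) (hp : 1 ≤ p) :
    ∃ C : ℝ, 0 < C ∧ ∀ N : ℕ, 1 ≤ N → ∃ ψ : Fin N → ℝ × ℝ → ℝ,
      (∀ j, ContDiff ℝ (⊤ : ℕ∞) (ψ j)) ∧ (∀ j, HasCompactSupport (ψ j)) ∧
      (∀ i j : Fin N, (∫ v : ℝ × ℝ, ψ i v * ψ j v) = if i = j then 1 else 0) ∧
      (∑ j : Fin N, ∫ v : ℝ × ℝ,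
          ((fderiv ℝ (ψ j) v (1, 0)) ^ 2 + (fderiv ℝ (ψ j) v (0, 1)) ^ 2 +
            (|v.1 * v.2| ^ p + |v.1| ^ p + |v.2| ^ p + 1) * (ψ j v) ^ 2)) ≤
        C * (N : ℝ) ^ ((2 * p + 1) / (p + 1)) / (1 + (Real.log N) ^ p) ^ (1 / (p + 1)) := by
  obtain ⟨K, hK, hfam⟩ := exists_orthonormal_family_energy_le hp
  have hp1 : 0 < p + 1 := by linarith
  set c := exp (p + 4) with hc
  have hc0 : 0 < c := exp_pos _
  have hcp : 4 * (p + 1) ≤ c := by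
    have h1 := add_one_le_exp (p + 1)
    have h2 := add_one_le_exp 3
    have h3 : c = exp 3 * exp (p + 1) := by
      rw [hc, ← exp_add]
      ring_nf
    nlinarith
  refine ⟨K * c ^ (p / (p + 1)), by positivity, fun N hN => ?_⟩
  have hN1 : (1 : ℝ) ≤ N := by exact_mod_cast hN
  have hN0 : (0 : ℝ) < N := by linarith
  set l := log N with hl
  have hl0 : 0 ≤ l := log_nonneg hN1
  set L := 1 + l with hL
  have hL1 : 1 ≤ L := by linarith
  have hL0 : 0 < L := by linarith
  set T := c * N / L with hT
  have hT0 : 0 < T := by positivity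
  set A := T ^ (1 / (p + 1)) with hA
  have hA0 : 0 < A := by positivity
  have hlog2 : log 2 ≤ 1 := by
    have := log_le_sub_one_of_pos (show (0 : ℝ) < 2 by norm_num)
    linarith
  have hlogA : L / (2 * (p + 1)) ≤ log (A / 2) := by
    have h1 : log L ≤ L / 2 := by
      have := log_le_sub_one_of_pos (half_pos hL0)
      rw [log_div hL0.ne' two_ne_zero] at this
      linarith
    have h2 : log T = p + 4 + l - log L := by
      rw [hT, log_div (by positivity) hL0.ne', log_mul hc0.ne' hN0.ne', hc, log_exp]
    have h3 : log A = (p + 4 + l - log L) / (p + 1) := by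
      rw [hA, log_rpow hT0, h2]
      ring
    have h4 : L / (2 * (p + 1)) + 1 ≤ log A := by
      rw [h3, le_div_iff₀ hp1]
      have : (L / (2 * (p + 1)) + 1) * (p + 1) = L / 2 + (p + 1) := by field_simp
      linarith
    rw [log_div hA0.ne' two_ne_zero]
    linarith
  have hA2 : 2 ≤ A := by
    have h1 : 0 < log (A / 2) := lt_of_lt_of_le (by positivity) hlogA
    have h2 := (log_pos_iff (by positivity)).1 h1
    linarith
  have hAT : A ^ (p + 1) = T := by
    rw [hA, ← rpow_mul hT0.le, one_div, inv_mul_cancel₀ hp1.ne', rpow_one]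
  have hcount : (N : ℝ) ≤ A ^ (p + 1) / 2 * log (A / 2) := by
    rw [hAT]
    calc (N : ℝ) ≤ N * (c / (4 * (p + 1))) := by
          refine le_mul_of_one_le_right hN0.le ?_
          rwa [one_le_div (by positivity)]
      _ = T / 2 * (L / (2 * (p + 1))) := by
          rw [hT]
          field_simp
          ring
      _ ≤ _ := by gcongr
  obtain ⟨ψ, h1, h2, h3, h4⟩ := hfam A N hA2 hcount
  refine ⟨ψ, h1, h2, h3, (Finset.sum_le_sum fun j _ => h4 j).trans ?_⟩
  rw [Finset.sum_const, Finset.card_univ, Fintype.card_fin, nsmul_eq_mul]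
  have hAp : A ^ p = c ^ (p / (p + 1)) * N ^ (p / (p + 1)) / L ^ (p / (p + 1)) := by
    rw [hA, ← rpow_mul hT0.le, hT, one_div_mul_eq_div, div_rpow (by positivity) hL0.le,
      mul_rpow hc0.le hN0.le]
  have hNp : (N : ℝ) ^ ((2 * p + 1) / (p + 1)) = N * N ^ (p / (p + 1)) := by
    rw [← rpow_one_add' hN0.le (by positivity)]
    congr 1
    field_simp
    ring
  have hden : (1 + l ^ p) ^ (1 / (p + 1)) ≤ L ^ (p / (p + 1)) := by
    have h5 : 1 + l ^ p ≤ L ^ p := by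
      simpa using add_rpow_le_rpow_add zero_le_one hl0 hp
    calc (1 + l ^ p) ^ (1 / (p + 1)) ≤ (L ^ p) ^ (1 / (p + 1)) :=
          rpow_le_rpow (by positivity) h5 (by positivity)
      _ = _ := by rw [← rpow_mul hL0.le, mul_one_div]
  rw [hAp, hNp]
  calc _ = K * c ^ (p / (p + 1)) * (N * N ^ (p / (p + 1))) / L ^ (p / (p + 1)) := by ring
    _ ≤ _ := by gcongr
end

section
/- Let p ≥ 1 and set Q(x,y) := |xy|^p + |x|^p + |y|^p + 1 and σ(λ,Q) := mes{(x,y) ∈ ℝ² : Q(x,y) < λ}. Then there exists λ_0 > 1 such that for all λ ≥ λ_0 one has (1/(2p)) λ^{1/p} ln λ ≤ σ(λ,Q) ≤ (8/p) λ^{1/p} ln λ. -/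
open MeasureTheory Real

lemma volume_regionBetween_neg_div_div {c b : ℝ} (hc : 0 ≤ c) (hb : 1 ≤ b) :
    volume (regionBetween (fun x => -(c / x)) (fun x => c / x) (Set.Ioc 1 b)) =
      ENNReal.ofReal (2 * c * Real.log b) := by
  have hcont : ContinuousOn (fun x : ℝ => c / x) (Set.Icc 1 b) :=
    continuousOn_const.div continuousOn_id fun x hx =>
      (zero_lt_one.trans_le hx.1).ne'
  have hint : IntegrableOn (fun x : ℝ => c / x) (Set.Ioc 1 b) :=
    (hcont.integrableOn_Icc).mono_set Set.Ioc_subset_Icc_self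
  have hneg : IntegrableOn (fun x : ℝ => -(c / x)) (Set.Ioc 1 b) := hint.neg
  rw [Measure.volume_eq_prod, volume_regionBetween_eq_integral hneg hint measurableSet_Ioc]
  · congr 1
    rw [← intervalIntegral.integral_of_le hb]
    calc ∫ x in (1 : ℝ)..b, ((fun x => c / x) - fun x => -(c / x)) x
        = ∫ x in (1 : ℝ)..b, 2 * c * x⁻¹ := by
          congr 1
          ext x
          simp only [Pi.sub_apply]
          ring
      _ = 2 * c * Real.log b := by
          rw [intervalIntegral.integral_const_mul, integral_inv_of_pos one_pos (by linarith),
            div_one]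
  · intro x hx
    have h : 0 ≤ c / x := div_nonneg hc (by linarith [hx.1])
    linarith

lemma volume_hyperbolic_cross {c b : ℝ} (hc : 0 ≤ c) (hb : 1 ≤ b) :
    volume {v : ℝ × ℝ | 1 < |v.1| ∧ |v.1| ≤ b ∧ |v.1 * v.2| < c} =
      ENNReal.ofReal (4 * c * Real.log b) := by
  set R := regionBetween (fun x => -(c / x)) (fun x => c / x) (Set.Ioc 1 b) with hR
  have hRm : MeasurableSet R :=
    measurableSet_regionBetween (by fun_prop) (by fun_prop) measurableSet_Ioc
  have hmem : ∀ v : ℝ × ℝ, v ∈ R ↔ 1 < v.1 ∧ v.1 ≤ b ∧ |v.1 * v.2| < c := by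
    intro v
    simp only [hR, regionBetween, Set.mem_ofPred_eq, Set.mem_Ioc, Set.mem_Ioo, ← abs_lt, and_assoc]
    refine and_congr_right fun h1 => and_congr_right fun _ => ?_
    have h0 : 0 < v.1 := by linarith
    rw [lt_div_iff₀ h0, abs_mul, abs_of_pos h0, mul_comm]
  have hsplit : {v : ℝ × ℝ | 1 < |v.1| ∧ |v.1| ≤ b ∧ |v.1 * v.2| < c} =
      R ∪ Neg.neg ⁻¹' R := by
    ext v
    simp only [Set.mem_ofPred_eq, Set.mem_union, Set.mem_preimage, hmem, Prod.fst_neg,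
      Prod.snd_neg, neg_mul_neg]
    rcases abs_cases v.1 with ⟨h, h'⟩ | ⟨h, h'⟩ <;> rw [h]
    · exact ⟨Or.inl, fun H => H.elim id fun H => absurd H.1 (by linarith)⟩
    · exact ⟨Or.inr, fun H => H.elim (fun H => absurd H.1 (by linarith)) id⟩
  have hdisj : Disjoint R (Neg.neg ⁻¹' R) := by
    rw [Set.disjoint_left]
    intro v h1 h2
    rw [Set.mem_preimage, hmem] at h2
    have h3 := h2.1
    rw [Prod.fst_neg] at h3
    linarith [((hmem v).1 h1).1]
  have hlog := Real.log_nonneg hb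
  rw [hsplit, measure_union hdisj (hRm.preimage measurable_neg), Measure.measure_preimage_neg,
    volume_regionBetween_neg_div_div hc hb, ← ENNReal.ofReal_add (by positivity) (by positivity)]
  congr 1
  ring

lemma sublevel_subset_hyperbolic_cross_union {p L : ℝ} (hp : 0 < p) (hL : 0 ≤ L) :
    {v : ℝ × ℝ | |v.1 * v.2| ^ p + |v.1| ^ p + |v.2| ^ p + 1 < L ^ p} ⊆
      {v : ℝ × ℝ | 1 < |v.1| ∧ |v.1| ≤ L ∧ |v.1 * v.2| < L} ∪
        Set.Icc (-1) 1 ×ˢ Set.Icc (-L) L := by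
  intro v hv
  simp only [Set.mem_ofPred_eq] at hv
  have h0 := Real.rpow_nonneg (abs_nonneg (v.1 * v.2)) p
  have h1 := Real.rpow_nonneg (abs_nonneg v.1) p
  have h2 := Real.rpow_nonneg (abs_nonneg v.2) p
  have root : ∀ t : ℝ, 0 ≤ t → t ^ p < L ^ p → t < L := fun t ht h =>
    (Real.rpow_lt_rpow_iff ht hL hp).1 h
  rcases lt_or_ge 1 |v.1| with h | h
  · exact Or.inl ⟨h, (root _ (abs_nonneg _) (by linarith)).le, root _ (abs_nonneg _) (by linarith)⟩
  · exact Or.inr ⟨abs_le.1 h, abs_le.1 (root _ (abs_nonneg _) (by linarith)).le⟩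

lemma hyperbolic_cross_subset_sublevel {p L : ℝ} (hp : 1 ≤ p) (hL : 0 ≤ L) :
    {v : ℝ × ℝ | 1 < |v.1| ∧ |v.1| ≤ L / 4 ∧ |v.1 * v.2| < L / 4} ⊆
      {v : ℝ × ℝ | |v.1 * v.2| ^ p + |v.1| ^ p + |v.2| ^ p + 1 < L ^ p} := by
  rintro v ⟨h1, h2, h3⟩
  have hp0 : 0 < p := by linarith
  have h4 : (4 : ℝ) ≤ 4 ^ p := Real.self_le_rpow_of_one_le (by norm_num) hp
  have hq : 4 * (L / 4) ^ p ≤ L ^ p := by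
    calc 4 * (L / 4) ^ p ≤ 4 ^ p * (L / 4) ^ p := by gcongr
      _ = L ^ p := by
        rw [← Real.mul_rpow (by norm_num) (by positivity)]
        congr 1
        ring
  have hx1 : 1 < |v.1| ^ p := Real.one_lt_rpow h1 hp0
  have hx : |v.1| ^ p ≤ (L / 4) ^ p := Real.rpow_le_rpow (abs_nonneg _) h2 hp0.le
  have hxy : |v.1 * v.2| ^ p < (L / 4) ^ p := Real.rpow_lt_rpow (abs_nonneg _) h3 hp0
  have hy : |v.2| ^ p ≤ |v.1 * v.2| ^ p := by
    refine Real.rpow_le_rpow (abs_nonneg _) ?_ hp0.le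
    rw [abs_mul]
    exact le_mul_of_one_le_left (abs_nonneg _) h1.le
  simp only [Set.mem_ofPred_eq]
  linarith

/-- two-sided asymptotic estimate for the sublevel-set measure
`σ(λ,Q)` of `Q(x,y) = |xy|^p + |x|^p + |y|^p + 1`. -/
theorem sublevel_measure_two_sided_bound (p : ℝ) (hp : 1 ≤ p) :
    ∃ lam₀ : ℝ, 1 < lam₀ ∧ ∀ lam : ℝ, lam₀ ≤ lam →
      (1 / (2 * p)) * lam ^ (1 / p) * Real.log lam ≤
        (volume {v : ℝ × ℝ |
          |v.1 * v.2| ^ p + |v.1| ^ p + |v.2| ^ p + 1 < lam}).toReal ∧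
      (volume {v : ℝ × ℝ |
          |v.1 * v.2| ^ p + |v.1| ^ p + |v.2| ^ p + 1 < lam}).toReal ≤
        (8 / p) * lam ^ (1 / p) * Real.log lam := by
  have hp0 : 0 < p := by linarith
  refine ⟨16 ^ p, Real.one_lt_rpow (by norm_num) hp0, fun lam hlam => ?_⟩
  have hlam0 : 0 < lam := lt_of_lt_of_le (by positivity) hlam
  obtain ⟨L, hLdef⟩ : ∃ L, L = lam ^ (1 / p) := ⟨_, rfl⟩
  have hL0 : 0 < L := hLdef ▸ Real.rpow_pos_of_pos hlam0 _
  have hLp : lam = L ^ p := by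
    rw [hLdef, ← Real.rpow_mul hlam0.le, one_div_mul_cancel hp0.ne', Real.rpow_one]
  have hL : 16 ≤ L := by
    rw [hLp] at hlam
    exact (Real.rpow_le_rpow_iff (by norm_num) hL0.le hp0).1 hlam
  have hlog : Real.log lam = p * Real.log L := by rw [hLp, Real.log_rpow hL0]
  have hlog16 : 2 * Real.log 4 ≤ Real.log L := by
    have h := Real.log_le_log (by norm_num) hL
    rwa [show (16 : ℝ) = 4 ^ 2 by norm_num, Real.log_pow, Nat.cast_ofNat] at h
  have hlog1 : 1 ≤ Real.log L := by
    rw [Real.le_log_iff_exp_le hL0]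
    linarith [Real.exp_one_lt_d9]
  have hupper : volume {v : ℝ × ℝ | |v.1 * v.2| ^ p + |v.1| ^ p + |v.2| ^ p + 1 < L ^ p} ≤
      ENNReal.ofReal (8 * L * Real.log L) := by
    refine (measure_mono (sublevel_subset_hyperbolic_cross_union hp0 hL0.le)).trans
      ((measure_union_le _ _).trans ?_)
    rw [volume_hyperbolic_cross hL0.le (by linarith), Measure.volume_eq_prod, Measure.prod_prod,
      Real.volume_Icc, Real.volume_Icc, ← ENNReal.ofReal_mul (by norm_num),
      ← ENNReal.ofReal_add (by positivity) (by linarith)]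
    refine ENNReal.ofReal_le_ofReal ?_
    nlinarith
  have hlower := measure_mono (μ := volume) (hyperbolic_cross_subset_sublevel hp hL0.le)
  rw [volume_hyperbolic_cross (by positivity) (by linarith),
    Real.log_div hL0.ne' (by norm_num)] at hlower
  rw [← hLdef, hlog, hLp]
  constructor
  · refine le_trans (le_of_eq_of_le (b := 1 / 2 * L * Real.log L) ?_ ?_)
      ((ENNReal.ofReal_le_iff_le_toReal (hupper.trans_lt ENNReal.ofReal_lt_top).ne).1 hlower)
    · field_simp
    · nlinarith
  · refine (ENNReal.toReal_le_of_le_ofReal (by positivity) hupper).trans_eq ?_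
    field_simp
end

section
/- Let p ≥ 1, set Q(x,y) := |xy|^p + |x|^p + |y|^p + 1 and Φ(λ,Q) := ∫_{ℝ²} max(λ − Q(x,y), 0) dx dy. Then there exists λ_0 > 1 such that for all λ ≥ λ_0 one has (1/(4(p+1))) λ^{(p+1)/p} ln λ ≤ Φ(λ,Q) ≤ (8/(p+1)) λ^{(p+1)/p} ln λ. -/
open MeasureTheory Real

/-- The one-dimensional integral `∫ (B - A|y|^p)₊ dy` in closed form. -/
lemma integral_max_sub_mul_abs_rpow {p A B : ℝ} (hp : 0 < p) (hA : 0 < A) (hB : 0 ≤ B) :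
    ∫ y : ℝ, max (B - A * |y| ^ p) 0 = 2 * p / (p + 1) * (B * (B / A) ^ (1 / p)) := by
  have hp1 : p + 1 ≠ 0 := by positivity
  rw [integral_comp_abs (f := fun y : ℝ => max (B - A * y ^ p) 0)]
  set c : ℝ := (B / A) ^ (1 / p) with hc
  have hc0 : 0 ≤ c := by positivity
  have hcp : A * c ^ p = B := by
    rw [hc, ← rpow_mul (by positivity), one_div_mul_cancel hp.ne', rpow_one]
    field_simp
  have hsub : ∫ y in Set.Ioi (0 : ℝ), max (B - A * y ^ p) 0
      = ∫ y in Set.Ioc 0 c, max (B - A * y ^ p) 0 := by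
    refine setIntegral_eq_of_subset_of_forall_sdiff_eq_zero measurableSet_Ioi
      Set.Ioc_subset_Ioi_self ?_
    rintro y ⟨hy0, hy⟩
    have hy0 : 0 < y := hy0
    have hcy : c ≤ y := by
      by_contra! h
      exact hy ⟨hy0, h.le⟩
    have : A * c ^ p ≤ A * y ^ p := by gcongr
    exact max_eq_right (by linarith)
  have hpos : ∫ y in Set.Ioc 0 c, max (B - A * y ^ p) 0
      = ∫ y in Set.Ioc 0 c, (B - A * y ^ p) := by
    refine setIntegral_congr_fun measurableSet_Ioc ?_
    rintro y ⟨hy0, hy⟩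
    have : A * y ^ p ≤ A * c ^ p := by gcongr
    exact max_eq_left (by linarith)
  rw [hsub, hpos, ← intervalIntegral.integral_of_le hc0, intervalIntegral.integral_sub (by simp)
    ((intervalIntegral.intervalIntegrable_rpow' (by linarith)).const_mul A),
    intervalIntegral.integral_const_mul, integral_rpow (Or.inl (by linarith)),
    intervalIntegral.integral_const, zero_rpow hp1, rpow_add_one' hc0 hp1]
  simp only [smul_eq_mul, sub_zero]
  rw [mul_div_assoc', ← mul_assoc, hcp]
  field_simp
  ring

/-- The positive part of `lam - (1 + |x|^p)(1 + |y|^p)` is integrable on the plane. -/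
lemma integrable_max_sub_rpow {p : ℝ} (hp : 1 ≤ p) {lam : ℝ} (hlam : 1 ≤ lam) :
    Integrable (fun v : ℝ × ℝ =>
      max (lam - (|v.1 * v.2| ^ p + |v.1| ^ p + |v.2| ^ p + 1)) 0) := by
  have hp0 : 0 ≤ p := by linarith
  have hlarge : ∀ t : ℝ, t ∉ Set.Icc (-lam) lam → lam ≤ |t| ^ p := by
    intro t ht
    have ht : lam < |t| := by
      by_contra! h
      exact ht (abs_le.mp h)
    exact ht.le.trans (self_le_rpow_of_one_le (hlam.trans ht.le) hp)
  refine Continuous.integrable_of_hasCompactSupport ?_ ?_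
  · have h : ∀ f : ℝ × ℝ → ℝ, Continuous f → Continuous fun v => |f v| ^ p := fun f hf =>
      hf.abs.rpow_const fun _ => Or.inr hp0
    have h1 := h (fun v => v.1 * v.2) (by fun_prop)
    have h2 := h (fun v => v.1) (by fun_prop)
    have h3 := h (fun v => v.2) (by fun_prop)
    fun_prop
  · refine HasCompactSupport.intro
      ((isCompact_Icc (a := -lam) (b := lam)).prod (isCompact_Icc (a := -lam) (b := lam))) ?_
    rintro ⟨x, y⟩ hxy
    have h1 : 0 ≤ |x * y| ^ p := by positivity
    have h2 : 0 ≤ |x| ^ p := by positivity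
    have h3 : 0 ≤ |y| ^ p := by positivity
    rw [Set.mem_prod, not_and_or] at hxy
    refine max_eq_right ?_
    rcases hxy with h | h <;> have := hlarge _ h <;> dsimp only at * <;> linarith

/-- The slice of the phase-space integral at a fixed first coordinate. -/
noncomputable def phaseSlice (p lam x : ℝ) : ℝ :=
  ∫ y : ℝ, max ((lam - (1 + x ^ p)) - (1 + x ^ p) * |y| ^ p) 0

lemma phaseSlice_of_le {p lam x : ℝ} (hp : 0 < p) (hx : 0 ≤ x) (h : 1 + x ^ p ≤ lam) :
    phaseSlice p lam x =
      2 * p / (p + 1) * ((lam - (1 + x ^ p)) * ((lam - (1 + x ^ p)) / (1 + x ^ p)) ^ (1 / p)) :=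
  integral_max_sub_mul_abs_rpow hp (by positivity) (by linarith)

lemma phaseSlice_of_ge {p lam x : ℝ} (hx : 0 ≤ x) (h : lam ≤ 1 + x ^ p) :
    phaseSlice p lam x = 0 := by
  refine integral_eq_zero_of_ae (Filter.Eventually.of_forall fun y => max_eq_right ?_)
  have : 0 ≤ (1 + x ^ p) * |y| ^ p := by positivity
  show lam - (1 + x ^ p) - (1 + x ^ p) * |y| ^ p ≤ 0
  linarith

lemma phaseSlice_nonneg (p lam x : ℝ) : 0 ≤ phaseSlice p lam x :=
  integral_nonneg fun _ => le_max_right _ _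

lemma max_sub_rpow_eq (p lam x y : ℝ) :
    max (lam - (|x * y| ^ p + |x| ^ p + |y| ^ p + 1)) 0
      = max ((lam - (1 + |x| ^ p)) - (1 + |x| ^ p) * |y| ^ p) 0 := by
  rw [abs_mul, mul_rpow (abs_nonneg _) (abs_nonneg _)]
  congr 1
  ring

lemma integral_max_sub_rpow_eq {p : ℝ} (hp : 1 ≤ p) {lam : ℝ} (hlam : 1 ≤ lam) :
    ∫ v : ℝ × ℝ, max (lam - (|v.1 * v.2| ^ p + |v.1| ^ p + |v.2| ^ p + 1)) 0
      = 2 * ∫ x in Set.Ioi (0 : ℝ), phaseSlice p lam x := by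
  rw [← integral_comp_abs (f := phaseSlice p lam), Measure.volume_eq_prod,
    integral_prod _ (integrable_max_sub_rpow hp hlam)]
  simp only [phaseSlice, max_sub_rpow_eq]

lemma integrableOn_phaseSlice {p : ℝ} (hp : 1 ≤ p) {lam : ℝ} (hlam : 1 ≤ lam) :
    IntegrableOn (phaseSlice p lam) (Set.Ioi 0) := by
  have h := integrable_max_sub_rpow hp hlam
  rw [Measure.volume_eq_prod] at h
  refine h.integral_prod_left.integrableOn.congr_fun (fun x hx => ?_) measurableSet_Ioi
  have hx : 0 < x := hx
  simp only [max_sub_rpow_eq]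
  simp only [phaseSlice, abs_of_pos hx]

lemma phaseSlice_le {p lam x a : ℝ} (hp : 0 < p) (hlam : 0 ≤ lam) (hx : 0 ≤ x) (ha : 0 < a)
    (h : a ^ p ≤ 1 + x ^ p) :
    phaseSlice p lam x ≤ 2 * p / (p + 1) * (lam * lam ^ (1 / p)) * a⁻¹ := by
  have hxp : 0 ≤ x ^ p := by positivity
  rcases le_total (1 + x ^ p) lam with hl | hl
  · have hap : (lam / a ^ p) ^ (1 / p) = lam ^ (1 / p) * a⁻¹ := by
      rw [div_rpow hlam (by positivity), ← rpow_mul ha.le, mul_one_div_cancel hp.ne', rpow_one,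
        div_eq_mul_inv]
    rw [phaseSlice_of_le hp hx hl, mul_assoc, mul_assoc lam, ← hap]
    have : 0 ≤ lam - (1 + x ^ p) := by linarith
    have : lam - (1 + x ^ p) ≤ lam := by linarith
    gcongr
  · rw [phaseSlice_of_ge hx hl]
    positivity

lemma le_phaseSlice {p lam x : ℝ} (hp : 1 ≤ p) (hx : 1 ≤ x) (h : x ^ p ≤ lam / 4) :
    2 * p / (p + 1) * (lam * lam ^ (1 / p)) / 8 * x⁻¹ ≤ phaseSlice p lam x := by
  have hp0 : 0 < p := by linarith
  have hxp : 1 ≤ x ^ p := one_le_rpow hx hp0.le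
  have hlam : 0 < lam := by linarith
  have hinv : (1 / 4 : ℝ) ≤ (1 / 4) ^ (1 / p) := by
    conv_lhs => rw [← rpow_one (1 / 4 : ℝ)]
    exact rpow_le_rpow_of_exponent_ge (by norm_num) (by norm_num)
      ((div_le_one hp0).mpr hp)
  have hap : (1 / 4 * (lam / x ^ p)) ^ (1 / p) = (1 / 4) ^ (1 / p) * (lam ^ (1 / p) * x⁻¹) := by
    rw [mul_rpow (by norm_num) (by positivity), div_rpow hlam.le (by positivity),
      ← rpow_mul (by positivity), mul_one_div_cancel hp0.ne', rpow_one, div_eq_mul_inv (lam ^ _)]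
  have hfrac : 1 / 4 * (lam / x ^ p) ≤ (lam - (1 + x ^ p)) / (1 + x ^ p) := by
    rw [mul_div_assoc', div_le_div_iff₀ (by positivity) (by positivity)]
    nlinarith
  rw [phaseSlice_of_le hp0 (by linarith) (by linarith)]
  calc 2 * p / (p + 1) * (lam * lam ^ (1 / p)) / 8 * x⁻¹
      = 2 * p / (p + 1) * (lam / 2 * (1 / 4 * (lam ^ (1 / p) * x⁻¹))) := by ring
    _ ≤ 2 * p / (p + 1) * (lam / 2 * ((1 / 4) ^ (1 / p) * (lam ^ (1 / p) * x⁻¹))) := by gcongr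
    _ = 2 * p / (p + 1) * (lam / 2 * (1 / 4 * (lam / x ^ p)) ^ (1 / p)) := by rw [hap]
    _ ≤ _ := by
      have : lam / 2 ≤ lam - (1 + x ^ p) := by linarith
      have : 0 ≤ lam - (1 + x ^ p) := by linarith
      gcongr

lemma setIntegral_phaseSlice_le {p : ℝ} (hp : 1 ≤ p) {lam : ℝ} (hlam : 1 ≤ lam) :
    ∫ x in Set.Ioi (0 : ℝ), phaseSlice p lam x
      ≤ 2 * p / (p + 1) * (lam * lam ^ (1 / p)) * (1 + Real.log lam / p) := by
  have hp0 : 0 < p := by linarith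
  have hlam0 : 0 ≤ lam := by linarith
  set C := 2 * p / (p + 1) * (lam * lam ^ (1 / p)) with hC
  set L := lam ^ (1 / p) with hL
  have hL1 : 1 ≤ L := one_le_rpow hlam (by positivity)
  have hLp : L ^ p = lam := by
    rw [hL, ← rpow_mul hlam0, one_div_mul_cancel hp0.ne', rpow_one]
  have hsub : ∫ x in Set.Ioi (0 : ℝ), phaseSlice p lam x
      = ∫ x in Set.Ioc 0 L, phaseSlice p lam x := by
    refine setIntegral_eq_of_subset_of_forall_sdiff_eq_zero measurableSet_Ioi
      Set.Ioc_subset_Ioi_self ?_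
    rintro y ⟨hy0, hy⟩
    have hy0 : 0 < y := hy0
    have hLy : L ≤ y := by
      by_contra! h
      exact hy ⟨hy0, h.le⟩
    have : L ^ p ≤ y ^ p := by gcongr
    exact phaseSlice_of_ge hy0.le (by linarith)
  have hint : ∀ a b : ℝ, 0 ≤ a → a ≤ b →
      IntervalIntegrable (phaseSlice p lam) volume a b := fun a b ha hab =>
    (intervalIntegrable_iff_integrableOn_Ioc_of_le hab).mpr
      ((integrableOn_phaseSlice hp hlam).mono_set fun x hx => ha.trans_lt hx.1)
  have h1 : ∫ x in (0 : ℝ)..1, phaseSlice p lam x ≤ ∫ _ in (0 : ℝ)..1, C := by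
    refine intervalIntegral.integral_mono_on zero_le_one (hint 0 1 le_rfl zero_le_one)
      (by simp) fun x hx => ?_
    have : 0 ≤ x ^ p := rpow_nonneg hx.1 p
    have h := phaseSlice_le hp0 hlam0 hx.1 one_pos (by rw [one_rpow]; linarith)
    rwa [inv_one, mul_one] at h
  have h2 : ∫ x in (1 : ℝ)..L, phaseSlice p lam x ≤ ∫ x in (1 : ℝ)..L, C * x⁻¹ := by
    refine intervalIntegral.integral_mono_on hL1 (hint 1 L zero_le_one hL1) ?_ fun x hx => ?_
    · refine (intervalIntegral.intervalIntegrable_inv (fun x hx => ?_) continuousOn_id).const_mul C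
      rw [Set.uIcc_of_le hL1] at hx
      exact (one_pos.trans_le hx.1).ne'
    · have hx0 : 0 < x := one_pos.trans_le hx.1
      exact phaseSlice_le hp0 hlam0 hx0.le hx0 (by linarith)
  rw [hsub, ← intervalIntegral.integral_of_le (by linarith),
    ← intervalIntegral.integral_add_adjacent_intervals (hint 0 1 le_rfl zero_le_one)
      (hint 1 L zero_le_one hL1)]
  rw [intervalIntegral.integral_const_mul, integral_inv_of_pos one_pos (by linarith), div_one, hL,
    Real.log_rpow (by linarith)] at h2
  simp only [intervalIntegral.integral_const, sub_zero, one_smul] at h1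
  calc _ ≤ C + C * (1 / p * Real.log lam) := add_le_add h1 h2
    _ = _ := by ring

lemma le_setIntegral_phaseSlice {p : ℝ} (hp : 1 ≤ p) {lam : ℝ} (hlam : 4 ≤ lam) :
    2 * p / (p + 1) * (lam * lam ^ (1 / p)) / 8 * (Real.log (lam / 4) / p)
      ≤ ∫ x in Set.Ioi (0 : ℝ), phaseSlice p lam x := by
  have hp0 : 0 < p := by linarith
  set C := 2 * p / (p + 1) * (lam * lam ^ (1 / p)) / 8 with hC
  set M := (lam / 4) ^ (1 / p) with hM
  have hM1 : 1 ≤ M := one_le_rpow (by linarith) (by positivity)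
  have hMp : M ^ p = lam / 4 := by
    rw [hM, ← rpow_mul (by linarith), one_div_mul_cancel hp0.ne', rpow_one]
  have hsubset : Set.Ioc 1 M ⊆ Set.Ioi (0 : ℝ) := fun x hx => one_pos.trans hx.1
  have hint := integrableOn_phaseSlice hp (show 1 ≤ lam by linarith)
  have h2 : ∫ x in (1 : ℝ)..M, C * x⁻¹ ≤ ∫ x in (1 : ℝ)..M, phaseSlice p lam x := by
    refine intervalIntegral.integral_mono_on hM1 ?_
      ((intervalIntegrable_iff_integrableOn_Ioc_of_le hM1).mpr (hint.mono_set hsubset))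
      fun x hx => ?_
    · refine (intervalIntegral.intervalIntegrable_inv (fun x hx => ?_) continuousOn_id).const_mul C
      rw [Set.uIcc_of_le hM1] at hx
      exact (one_pos.trans_le hx.1).ne'
    · have hx0 : 0 < x := one_pos.trans_le hx.1
      refine le_phaseSlice hp hx.1 (hMp ▸ ?_)
      exact rpow_le_rpow hx0.le hx.2 hp0.le
  rw [intervalIntegral.integral_const_mul, integral_inv_of_pos one_pos (by linarith), div_one, hM,
    Real.log_rpow (by linarith), ← hM, intervalIntegral.integral_of_le hM1] at h2
  calc C * (Real.log (lam / 4) / p) = C * (1 / p * Real.log (lam / 4)) := by ring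
    _ ≤ _ := h2
    _ ≤ _ := setIntegral_mono_set hint
      (Filter.Eventually.of_forall fun x => phaseSlice_nonneg p lam x) hsubset.eventuallyLE

/-- two-sided asymptotic estimate for the phase-space integral `Φ(λ,Q)`. -/
theorem phase_space_integral_two_sided_bound (p : ℝ) (hp : 1 ≤ p) :
    ∃ lam₀ : ℝ, 1 < lam₀ ∧ ∀ lam : ℝ, lam₀ ≤ lam →
      (1 / (4 * (p + 1))) * lam ^ ((p + 1) / p) * Real.log lam ≤
        (∫ v : ℝ × ℝ,
          max (lam - (|v.1 * v.2| ^ p + |v.1| ^ p + |v.2| ^ p + 1)) 0) ∧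
      (∫ v : ℝ × ℝ,
          max (lam - (|v.1 * v.2| ^ p + |v.1| ^ p + |v.2| ^ p + 1)) 0) ≤
        (8 / (p + 1)) * lam ^ ((p + 1) / p) * Real.log lam := by
  have hp0 : 0 < p := by linarith
  refine ⟨max 16 (Real.exp p), lt_max_of_lt_left (by norm_num), fun lam hlam => ?_⟩
  have h16 : 16 ≤ lam := (le_max_left _ _).trans hlam
  have hlam0 : 0 < lam := by linarith
  have hlog : p ≤ Real.log lam :=
    (Real.le_log_iff_exp_le hlam0).mpr ((le_max_right _ _).trans hlam)
  have hpow : lam ^ ((p + 1) / p) = lam * lam ^ (1 / p) := by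
    rw [add_div, div_self hp0.ne', rpow_add hlam0, rpow_one]
  rw [integral_max_sub_rpow_eq hp (by linarith), hpow]
  have hD : 0 ≤ lam * lam ^ (1 / p) := by positivity
  constructor
  · refine le_trans ?_ (mul_le_mul_of_nonneg_left
      (le_setIntegral_phaseSlice hp (by linarith : (4 : ℝ) ≤ lam)) zero_le_two)
    have h4 : Real.log lam / 2 ≤ Real.log (lam / 4) := by
      have h := Real.log_le_log (by norm_num) h16
      rw [show (16 : ℝ) = 4 ^ 2 by norm_num, Real.log_pow] at h
      rw [Real.log_div hlam0.ne' (by norm_num)]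
      push_cast at h
      linarith
    calc 1 / (4 * (p + 1)) * (lam * lam ^ (1 / p)) * Real.log lam
        = 1 / (2 * (p + 1)) * (lam * lam ^ (1 / p)) * (Real.log lam / 2) := by
          field_simp
          ring
      _ ≤ 1 / (2 * (p + 1)) * (lam * lam ^ (1 / p)) * Real.log (lam / 4) := by gcongr
      _ = _ := by
          field_simp
          ring
  · refine (mul_le_mul_of_nonneg_left
      (setIntegral_phaseSlice_le hp (by linarith : (1 : ℝ) ≤ lam)) zero_le_two).trans ?_
    calc 2 * (2 * p / (p + 1) * (lam * lam ^ (1 / p)) * (1 + Real.log lam / p))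
        = 4 / (p + 1) * (lam * lam ^ (1 / p)) * (p + Real.log lam) := by
          field_simp
          ring
      _ ≤ 4 / (p + 1) * (lam * lam ^ (1 / p)) * (Real.log lam + Real.log lam) := by gcongr
      _ = _ := by ring
end

section
/- Let p ≥ 1 and set Q(x,y) := |xy|^p + |x|^p + |y|^p + 1. Then for all (x,y), (x₁,y₁) ∈ ℝ² with (x−x₁)² + (y−y₁)² ≤ 4 one has |Q(x,y) − Q(x₁,y₁)| ≤ 12·16^p · p · ((x−x₁)² + (y−y₁)²)^{1/2} · Q(x,y). -/
open Real

/-- The tangent-line bound for the convex power function at the larger endpoint. -/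
lemma rpow_sub_rpow_le_mul {p a b : ℝ} (hp : 1 ≤ p) (hb : 0 ≤ b) (hab : b ≤ a) :
    a ^ p - b ^ p ≤ p * a ^ (p - 1) * (a - b) := by
  rcases (hb.trans hab).eq_or_lt with rfl | ha
  · obtain rfl : b = 0 := le_antisymm hab hb
    simp
  have hdiv : 0 ≤ b / a := div_nonneg hb ha.le
  have bernoulli := one_add_mul_self_le_rpow_one_add (s := b / a - 1) (by linarith) hp
  rw [add_sub_cancel, div_rpow hb ha.le, le_div_iff₀ (rpow_pos_of_pos ha p)] at bernoulli
  have hpow : a ^ p = a ^ (p - 1) * a := by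
    rw [← rpow_add_one ha.ne', sub_add_cancel]
  have hexpand : (1 + p * (b / a - 1)) * a ^ p = a ^ p - p * a ^ (p - 1) * (a - b) := by
    rw [hpow]
    field_simp
    ring
  linarith

lemma abs_rpow_sub_rpow_le {p M a b : ℝ} (hp : 1 ≤ p) (hM : 1 ≤ M) (ha : 0 ≤ a) (hb : 0 ≤ b)
    (haM : a ≤ M) (hbM : b ≤ M) : |a ^ p - b ^ p| ≤ p * M ^ p * |a - b| := by
  wlog hab : b ≤ a generalizing a b
  · rw [abs_sub_comm, abs_sub_comm a]
    exact this hb ha hbM haM (le_of_not_ge hab)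
  rw [abs_of_nonneg (sub_nonneg.2 hab),
    abs_of_nonneg (sub_nonneg.2 (rpow_le_rpow hb hab (by linarith)))]
  refine (rpow_sub_rpow_le_mul hp hb hab).trans ?_
  have hpow : a ^ (p - 1) ≤ M ^ p :=
    (rpow_le_rpow ha haM (by linarith)).trans (rpow_le_rpow_of_exponent_le hM (by linarith))
  have := sub_nonneg.2 hab
  gcongr

lemma add_two_rpow_le {p t : ℝ} (hp : 0 ≤ p) (ht : 0 ≤ t) :
    (t + 2) ^ p ≤ 3 ^ p * (t ^ p + 1) := by
  have htp : 0 ≤ t ^ p := rpow_nonneg ht p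
  rcases le_total t 1 with h | h
  · calc (t + 2) ^ p ≤ 3 ^ p := rpow_le_rpow (by linarith) (by linarith) hp
      _ ≤ 3 ^ p * (t ^ p + 1) := le_mul_of_one_le_right (by positivity) (by linarith)
  · calc (t + 2) ^ p ≤ (3 * t) ^ p := rpow_le_rpow (by linarith) (by linarith) hp
      _ = 3 ^ p * t ^ p := mul_rpow (by norm_num) ht
      _ ≤ 3 ^ p * (t ^ p + 1) := by gcongr; linarith

lemma abs_le_abs_add_of_abs_sub_le {x x₁ d : ℝ} (h : |x - x₁| ≤ d) : |x₁| ≤ |x| + d := by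
  have := abs_sub_abs_le_abs_sub x₁ x
  rw [abs_sub_comm] at this
  linarith

lemma abs_abs_rpow_sub_le {p x x₁ : ℝ} (hp : 1 ≤ p) (h : |x - x₁| ≤ 2) :
    |(|x| ^ p - |x₁| ^ p)| ≤ p * (3 ^ p * (|x| ^ p + 1)) * |x - x₁| := by
  have hx := abs_nonneg x
  have hx₁ := abs_le_abs_add_of_abs_sub_le h
  calc |(|x| ^ p - |x₁| ^ p)| ≤ p * (|x| + 2) ^ p * |(|x| - |x₁|)| :=
        abs_rpow_sub_rpow_le hp (by linarith) hx (abs_nonneg _) (by linarith) hx₁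
    _ ≤ p * (3 ^ p * (|x| ^ p + 1)) * |x - x₁| := by
        have hpow := add_two_rpow_le (by linarith : 0 ≤ p) hx
        exact mul_le_mul (by gcongr) (abs_abs_sub_abs_le x x₁) (abs_nonneg _) (by positivity)

lemma abs_rpow_add_one_le {p x x₁ : ℝ} (hp : 0 ≤ p) (h : |x - x₁| ≤ 2) :
    |x₁| ^ p + 1 ≤ 2 * 3 ^ p * (|x| ^ p + 1) := by
  have hx₁ := abs_le_abs_add_of_abs_sub_le h
  have hle := (rpow_le_rpow (abs_nonneg _) hx₁ hp).trans (add_two_rpow_le hp (abs_nonneg x))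
  have hone : (1 : ℝ) ≤ 3 ^ p * (|x| ^ p + 1) :=
    one_le_mul_of_one_le_of_one_le (one_le_rpow (by norm_num) hp)
      (by linarith [rpow_nonneg (abs_nonneg x) p])
  linarith

/-- local Lipschitz-type estimate for
`Q(x,y) = |xy|^p + |x|^p + |y|^p + 1`. -/
theorem potential_local_lipschitz (p : ℝ) (hp : 1 ≤ p)
    (x y x₁ y₁ : ℝ) (h : (x - x₁) ^ 2 + (y - y₁) ^ 2 ≤ 4) :
    |(|x * y| ^ p + |x| ^ p + |y| ^ p + 1) -
        (|x₁ * y₁| ^ p + |x₁| ^ p + |y₁| ^ p + 1)| ≤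
      12 * (16 : ℝ) ^ p * p * ((x - x₁) ^ 2 + (y - y₁) ^ 2) ^ ((1 : ℝ) / 2) *
        (|x * y| ^ p + |x| ^ p + |y| ^ p + 1) := by
  rw [← sqrt_eq_rpow]
  set r := √((x - x₁) ^ 2 + (y - y₁) ^ 2)
  have hr : r ≤ 2 := sqrt_le_iff.2 ⟨by norm_num, by linarith⟩
  have hdx : |x - x₁| ≤ r := abs_le_sqrt (by linarith [sq_nonneg (y - y₁)])
  have hdy : |y - y₁| ≤ r := abs_le_sqrt (by linarith [sq_nonneg (x - x₁)])
  have hr₀ : 0 ≤ r := sqrt_nonneg _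
  have hp₀ : 0 ≤ p := by linarith
  have hX := abs_abs_rpow_sub_le hp (hdx.trans hr)
  have hY := abs_abs_rpow_sub_le hp (hdy.trans hr)
  have hX₁ := abs_rpow_add_one_le hp₀ (hdx.trans hr)
  have h3 : (3 : ℝ) ^ p ≤ 16 ^ p := rpow_le_rpow (by norm_num) (by norm_num) hp₀
  have h9 : (3 : ℝ) ^ p * 3 ^ p ≤ 16 ^ p := by
    rw [← mul_rpow (by norm_num) (by norm_num)]
    exact rpow_le_rpow (by norm_num) (by norm_num) hp₀
  rw [abs_mul, abs_mul, mul_rpow (abs_nonneg _) (abs_nonneg _),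
    mul_rpow (abs_nonneg _) (abs_nonneg _)]
  have hu : 0 ≤ |x| ^ p := by positivity
  have hv : 0 ≤ |y| ^ p := by positivity
  have hu₁ : 0 ≤ |x₁| ^ p := by positivity
  generalize |x| ^ p = u at *
  generalize |y| ^ p = v at *
  generalize |x₁| ^ p = u₁ at *
  generalize |y₁| ^ p = v₁ at *
  have hc : (0 : ℝ) ≤ 3 ^ p := by positivity
  calc |u * v + u + v + 1 - (u₁ * v₁ + u₁ + v₁ + 1)|
      = |(u - u₁) * (v + 1) + (u₁ + 1) * (v - v₁)| := by ring_nf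
    _ ≤ |u - u₁| * (v + 1) + (u₁ + 1) * |v - v₁| := by
        refine (abs_add_le _ _).trans_eq ?_
        rw [abs_mul, abs_mul, abs_of_nonneg (by linarith : 0 ≤ v + 1),
          abs_of_nonneg (by linarith : 0 ≤ u₁ + 1)]
    _ ≤ p * (3 ^ p * (u + 1)) * r * (v + 1)
          + 2 * 3 ^ p * (u + 1) * (p * (3 ^ p * (v + 1)) * r) := by
        have hX' : |u - u₁| ≤ p * (3 ^ p * (u + 1)) * r := hX.trans (by gcongr)
        have hY' : |v - v₁| ≤ p * (3 ^ p * (v + 1)) * r := hY.trans (by gcongr)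
        gcongr
    _ = (3 ^ p + 2 * (3 ^ p * 3 ^ p)) * (p * r * ((u + 1) * (v + 1))) := by ring
    _ ≤ 12 * 16 ^ p * (p * r * ((u + 1) * (v + 1))) := by
        gcongr
        linarith
    _ = 12 * 16 ^ p * p * r * (u * v + u + v + 1) := by ring
end

section
/- Let D := {(x,y) ∈ ℝ² : |xy| ≤ 1} and let u ∈ C_c^∞(ℝ²) be a real-valued function whose support is contained in the open set {(x,y) : |xy| < 1}. Then ∫_D (x² + y²) u(x,y)² dx dy ≤ ∫_D |∇u(x,y)|² dx dy. -/
open MeasureTheory Real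

section DirectionalHardy

variable {E : Type*} [NormedAddCommGroup E] [NormedSpace ℝ E]

/-- The directional derivative of a compactly supported `C¹` function has zero integral. -/
theorem integral_fderiv_apply_eq_zero_of_hasCompactSupport [FiniteDimensional ℝ E]
    [MeasurableSpace E] [BorelSpace E] (μ : Measure E) [μ.IsAddHaarMeasure] {g : E → ℝ}
    (hg : ContDiff ℝ 1 g) (hg' : HasCompactSupport g) (e : E) :
    Integrable (fun v ↦ fderiv ℝ g v e) μ ∧ ∫ v, fderiv ℝ g v e ∂μ = 0 := by
  have hd : Integrable (fun v ↦ fderiv ℝ g v e) μ :=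
    ((hg.continuous_fderiv one_ne_zero).clm_apply
      continuous_const).integrable_of_hasCompactSupport (hg'.fderiv_apply ℝ e)
  have h := integral_mul_fderiv_eq_neg_fderiv_mul_of_integrable (μ := μ) (f := fun _ ↦ (1 : ℝ))
    (g := g) (v := e) (by simp) (by simpa using hd)
    (by simpa using hg.continuous.integrable_of_hasCompactSupport hg')
    (fun x _ ↦ differentiableAt_const _)
    (fun x _ ↦ hg.differentiable one_ne_zero x)
  exact ⟨hd, by simpa using h⟩

variable {u q : E → ℝ} {c : E →L[ℝ] ℝ}

/-- If `cos ∘ q` does not vanish on the topological support of `u`, then `c * tan q * u ^ 2` is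
`C¹`. -/
theorem contDiff_mul_tan_comp_mul_sq (hu : ContDiff ℝ 1 u) (hq : ContDiff ℝ 1 q)
    (hcos : ∀ v ∈ tsupport u, cos (q v) ≠ 0) :
    ContDiff ℝ 1 fun v ↦ c v * tan (q v) * u v ^ 2 := by
  refine contDiff_iff_contDiffAt.2 fun v ↦ ?_
  by_cases hv : v ∈ tsupport u
  · exact (c.contDiff.contDiffAt.mul
      ((contDiffAt_tan.2 (hcos v hv)).comp v hq.contDiffAt)).mul (hu.contDiffAt.pow 2)
  · refine (contDiffAt_const (c := (0 : ℝ))).congr_of_eventuallyEq ?_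
    filter_upwards [notMem_tsupport_iff_eventuallyEq.1 hv] with w hw
    simp [hw]

/-- Completing the square: if `q` has directional derivative `c` along `e`, and `c` is constant
along `e`, then `(∂ₑu)² - c² u² + ∂ₑ(c tan(q) u²) = (∂ₑu + c tan(q) u)²` is nonnegative. -/
theorem sq_sub_add_fderiv_mul_tan_nonneg (hu : ContDiff ℝ 1 u) (hq : ContDiff ℝ 1 q)
    (hcos : ∀ v ∈ tsupport u, cos (q v) ≠ 0) {e : E} (hc : c e = 0)
    (hqc : ∀ v, fderiv ℝ q v e = c v) (v : E) :
    0 ≤ fderiv ℝ u v e ^ 2 - c v ^ 2 * u v ^ 2 +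
      fderiv ℝ (fun w ↦ c w * tan (q w) * u w ^ 2) v e := by
  by_cases hv : v ∈ tsupport u
  · have hcv := hcos v hv
    have h := ((c.hasFDerivAt (x := v)).mul
      ((hasDerivAt_tan hcv).comp_hasFDerivAt v
        (hq.differentiable one_ne_zero v).hasFDerivAt)).mul
      ((hu.differentiable one_ne_zero v).hasFDerivAt.pow 2)
    have h' : fderiv ℝ (fun w ↦ c w * tan (q w) * u w ^ 2) v e =
        c v * tan (q v) * (2 * u v * fderiv ℝ u v e) +
          u v ^ 2 * (c v * ((1 + tan (q v) ^ 2) * c v)) := by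
      have htan : 1 / cos (q v) ^ 2 = 1 + tan (q v) ^ 2 := by
        rw [tan_eq_sin_div_cos]
        field_simp
        linarith [sin_sq_add_cos_sq (q v)]
      refine (congrArg (fun L : E →L[ℝ] ℝ ↦ L e) h.fderiv).trans ?_
      simp [hc, hqc, ← htan]
    rw [h']
    linarith [sq_nonneg (fderiv ℝ u v e + c v * tan (q v) * u v)]
  · have hu0 := notMem_tsupport_iff_eventuallyEq.1 hv
    have h0 : (fun w ↦ c w * tan (q w) * u w ^ 2) =ᶠ[nhds v] fun _ ↦ 0 := by
      filter_upwards [hu0] with w hw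
      simp [hw]
    rw [h0.fderiv_eq, image_eq_zero_of_notMem_tsupport hv]
    simpa using sq_nonneg _

/-- A Hardy inequality for one directional derivative. -/
theorem integral_sq_mul_sq_le_integral_fderiv_sq [FiniteDimensional ℝ E]
    [MeasurableSpace E] [BorelSpace E] (μ : Measure E) [μ.IsAddHaarMeasure]
    (hu : ContDiff ℝ 1 u) (hu' : HasCompactSupport u) (hq : ContDiff ℝ 1 q)
    (hcos : ∀ v ∈ tsupport u, cos (q v) ≠ 0) {e : E} (hc : c e = 0)
    (hqc : ∀ v, fderiv ℝ q v e = c v) :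
    Integrable (fun v ↦ c v ^ 2 * u v ^ 2) μ ∧ Integrable (fun v ↦ fderiv ℝ u v e ^ 2) μ ∧
      ∫ v, c v ^ 2 * u v ^ 2 ∂μ ≤ ∫ v, fderiv ℝ u v e ^ 2 ∂μ := by
  have hsq : HasCompactSupport fun v ↦ u v ^ 2 :=
    hu'.comp_left (g := fun t : ℝ ↦ t ^ 2) (by simp)
  have hd : Continuous fun v ↦ fderiv ℝ u v e :=
    (hu.continuous_fderiv one_ne_zero).clm_apply continuous_const
  have hdsq : HasCompactSupport fun v ↦ fderiv ℝ u v e ^ 2 :=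
    (hu'.fderiv_apply ℝ e).comp_left (g := fun t : ℝ ↦ t ^ 2) (by simp)
  have h₁ : Integrable (fun v ↦ c v ^ 2 * u v ^ 2) μ :=
    ((c.continuous.pow 2).mul (hu.continuous.pow 2)).integrable_of_hasCompactSupport hsq.mul_left
  have h₂ : Integrable (fun v ↦ fderiv ℝ u v e ^ 2) μ :=
    (hd.pow 2).integrable_of_hasCompactSupport hdsq
  obtain ⟨h₃, h₄⟩ := integral_fderiv_apply_eq_zero_of_hasCompactSupport μ
    (contDiff_mul_tan_comp_mul_sq (c := c) hu hq hcos) hsq.mul_left e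
  refine ⟨h₁, h₂, ?_⟩
  have h : 0 ≤ ∫ v, fderiv ℝ u v e ^ 2 - c v ^ 2 * u v ^ 2 +
      fderiv ℝ (fun w ↦ c w * tan (q w) * u w ^ 2) v e ∂μ :=
    integral_nonneg fun v ↦ sq_sub_add_fderiv_mul_tan_nonneg hu hq hcos hc hqc v
  rw [integral_add (by exact h₂.sub h₁) h₃, integral_sub h₂ h₁, h₄] at h
  linarith

end DirectionalHardy

/-- Hardy-type inequality on the hyperbolic-horn region
`D = {(x,y) : |xy| ≤ 1}` for smooth functions supported inside `{|xy| < 1}`. -/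
theorem horn_hardy_inequality (u : ℝ × ℝ → ℝ) (hu : ContDiff ℝ (⊤ : ℕ∞) u)
    (hsupp : HasCompactSupport u)
    (hin : Function.support u ⊆ {v : ℝ × ℝ | |v.1 * v.2| < 1}) :
    (∫ v in {v : ℝ × ℝ | |v.1 * v.2| ≤ 1}, (v.1 ^ 2 + v.2 ^ 2) * (u v) ^ 2) ≤
      ∫ v in {v : ℝ × ℝ | |v.1 * v.2| ≤ 1},
        ((fderiv ℝ u v (1, 0)) ^ 2 + (fderiv ℝ u v (0, 1)) ^ 2) := by
  have hu₁ : ContDiff ℝ 1 u := hu.of_le (by exact_mod_cast le_top)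
  have htsupp : tsupport u ⊆ {v : ℝ × ℝ | |v.1 * v.2| ≤ 1} :=
    closure_minimal (hin.trans (Set.ofPred_subset_ofPred.2 fun _ ↦ le_of_lt))
      (isClosed_le (by fun_prop) continuous_const)
  rw [setIntegral_eq_integral_of_forall_compl_eq_zero fun v hv ↦ by
      simp [image_eq_zero_of_notMem_tsupport fun h ↦ hv (htsupp h)],
    setIntegral_eq_integral_of_forall_compl_eq_zero fun v hv ↦ by
      simp [fderiv_of_notMem_tsupport (𝕜 := ℝ) fun h ↦ hv (htsupp h)]]
  have hq : ContDiff ℝ 1 fun v : ℝ × ℝ ↦ v.1 * v.2 := by fun_prop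
  have hcos : ∀ v ∈ tsupport u, cos (v.1 * v.2) ≠ 0 := fun v hv ↦ by
    have h := abs_le.1 (Set.mem_ofPred.1 (htsupp hv))
    exact (cos_pos_of_mem_Ioo ⟨by linarith [pi_gt_three, h.1],
      by linarith [pi_gt_three, h.2]⟩).ne'
  have hfderiv (v e : ℝ × ℝ) :
      fderiv ℝ (fun v : ℝ × ℝ ↦ v.1 * v.2) v e = v.1 * e.2 + v.2 * e.1 := by
    rw [fderiv_fun_mul differentiableAt_fst differentiableAt_snd, fderiv_fst, fderiv_snd]
    simp
  obtain ⟨hx₁, hx₂, hx⟩ := integral_sq_mul_sq_le_integral_fderiv_sq volume hu₁ hsupp hq hcos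
    (c := ContinuousLinearMap.snd ℝ ℝ ℝ) (e := (1, 0)) (by simp) (by simp [hfderiv])
  obtain ⟨hy₁, hy₂, hy⟩ := integral_sq_mul_sq_le_integral_fderiv_sq volume hu₁ hsupp hq hcos
    (c := ContinuousLinearMap.fst ℝ ℝ ℝ) (e := (0, 1)) (by simp) (by simp [hfderiv])
  simp only [ContinuousLinearMap.coe_fst', ContinuousLinearMap.coe_snd'] at hx₁ hx hy₁ hy
  simp only [add_mul]
  rw [integral_add hy₁ hx₁, integral_add hx₂ hy₂]
  linarith
end

section
/- Let u ∈ C_c^∞(ℝ²) be a real-valued function such that u(x,y) = 0 whenever xy ≥ 1. Then ∫_0^∞ ∫_0^{1/y} y² u(x,y)² dx dy ≤ ∫_0^∞ ∫_0^{1/y} (∂u/∂x)(x,y)² dx dy. -/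
open MeasureTheory Real Set

/-- Cauchy–Schwarz against a constant on an interval. -/
theorem sq_intervalIntegral_le_mul_integral_sq {g : ℝ → ℝ} (hg : Continuous g) {a b : ℝ}
    (hab : a < b) : (∫ t in a..b, g t) ^ 2 ≤ (b - a) * ∫ t in a..b, g t ^ 2 := by
  set A := ∫ t in a..b, g t with hA
  have hnn : 0 ≤ ∫ t in a..b, ((b - a) * g t - A) ^ 2 :=
    intervalIntegral.integral_nonneg hab.le fun t _ => sq_nonneg _
  have hexp : ∫ t in a..b, ((b - a) * g t - A) ^ 2 =
      (b - a) * ((b - a) * (∫ t in a..b, g t ^ 2) - A ^ 2) := by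
    have hfun : (fun t => ((b - a) * g t - A) ^ 2) =
        fun t => (b - a) ^ 2 * g t ^ 2 - 2 * (b - a) * A * g t + A ^ 2 := by
      ext t; ring
    rw [hfun, intervalIntegral.integral_add, intervalIntegral.integral_sub,
      intervalIntegral.integral_const_mul, intervalIntegral.integral_const_mul,
      intervalIntegral.integral_const, ← hA, smul_eq_mul]
    · ring
    all_goals exact Continuous.intervalIntegrable (by fun_prop) _ _
  rw [hexp] at hnn
  have := nonneg_of_mul_nonneg_right hnn (sub_pos.2 hab)
  linarith

/-- Poincaré inequality on `(0, b)` for functions vanishing at the right endpoint. -/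
theorem setIntegral_sq_le_of_eq_zero_right {f g : ℝ → ℝ} (hfg : ∀ t, HasDerivAt f (g t) t)
    (hg : Continuous g) {b : ℝ} (hb : 0 < b) (hfb : f b = 0) :
    ∫ x in Ioo 0 b, f x ^ 2 ≤ b ^ 2 * ∫ x in Ioo 0 b, g x ^ 2 := by
  have hf : Continuous f := continuous_iff_continuousAt.2 fun t => (hfg t).continuousAt
  rw [← integral_Ioc_eq_integral_Ioo, ← integral_Ioc_eq_integral_Ioo,
    ← intervalIntegral.integral_of_le hb.le, ← intervalIntegral.integral_of_le hb.le]
  set K := ∫ x in (0 : ℝ)..b, g x ^ 2 with hK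
  have hg2 : ∀ c d : ℝ, IntervalIntegrable (fun t => g t ^ 2) volume c d := fun c d =>
    (hg.pow 2).intervalIntegrable c d
  have hK0 : 0 ≤ K := intervalIntegral.integral_nonneg hb.le fun t _ => sq_nonneg _
  have hpt : ∀ x ∈ Icc 0 b, f x ^ 2 ≤ b * K := by
    rintro x ⟨hx0, hxb⟩
    rcases hxb.eq_or_lt with rfl | hxb
    · rw [hfb, zero_pow two_ne_zero]
      exact mul_nonneg hb.le hK0
    have hftc : ∫ t in x..b, g t = -f x := by
      rw [intervalIntegral.integral_eq_sub_of_hasDerivAt (fun t _ => hfg t)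
        (hg.intervalIntegrable x b), hfb, zero_sub]
    have hcs := sq_intervalIntegral_le_mul_integral_sq hg hxb
    rw [hftc, neg_sq] at hcs
    have hmono : ∫ t in x..b, g t ^ 2 ≤ K := by
      rw [hK, ← intervalIntegral.integral_add_adjacent_intervals (hg2 0 x) (hg2 x b)]
      exact le_add_of_nonneg_left
        (intervalIntegral.integral_nonneg hx0 fun t _ => sq_nonneg _)
    calc f x ^ 2 ≤ (b - x) * ∫ t in x..b, g t ^ 2 := hcs
      _ ≤ (b - x) * K := mul_le_mul_of_nonneg_left hmono (by linarith)
      _ ≤ b * K := mul_le_mul_of_nonneg_right (by linarith) hK0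
  calc ∫ x in (0 : ℝ)..b, f x ^ 2 ≤ ∫ _ in (0 : ℝ)..b, b * K :=
        intervalIntegral.integral_mono_on hb.le ((hf.pow 2).intervalIntegrable 0 b)
          intervalIntegrable_const hpt
    _ = b ^ 2 * K := by rw [intervalIntegral.integral_const, smul_eq_mul]; ring

/-- The slice integrals over the horn of an integrable function are integrable. -/
theorem integrable_integral_horn_slice {h : ℝ × ℝ → ℝ} (hh : Integrable h) :
    Integrable fun y : ℝ => ∫ x in Ioo (0 : ℝ) (1 / y), h (x, y) := by
  have hS : MeasurableSet {p : ℝ × ℝ | 0 < p.1 ∧ p.1 < 1 / p.2} :=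
    (measurableSet_lt measurable_const measurable_fst).inter
      (measurableSet_lt measurable_fst (measurable_const.div measurable_snd))
  have hint := (hh.indicator hS).integral_prod_right
  refine hint.congr (Filter.Eventually.of_forall fun y => ?_)
  simp only
  rw [← integral_indicator measurableSet_Ioo]
  rfl

/-- Hardy-type inequality in the first-quadrant horn
`D_{++} = {(x,y) : x ≥ 0, y ≥ 0, xy ≤ 1}`. -/
theorem first_quadrant_horn_inequality (u : ℝ × ℝ → ℝ) (hu : ContDiff ℝ (⊤ : ℕ∞) u)
    (hsupp : HasCompactSupport u)
    (hzero : ∀ x y : ℝ, 1 ≤ x * y → u (x, y) = 0) :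
    (∫ y in Set.Ioi (0 : ℝ), ∫ x in Set.Ioo (0 : ℝ) (1 / y), y ^ 2 * (u (x, y)) ^ 2) ≤
      ∫ y in Set.Ioi (0 : ℝ), ∫ x in Set.Ioo (0 : ℝ) (1 / y),
        (fderiv ℝ u (x, y) (1, 0)) ^ 2 := by
  have hcont : Continuous fun p : ℝ × ℝ => fderiv ℝ u p (1, 0) :=
    (hu.continuous_fderiv (by simp)).clm_apply continuous_const
  have hcs : HasCompactSupport fun p : ℝ × ℝ => fderiv ℝ u p (1, 0) ^ 2 :=
    (hsupp.fderiv_apply ℝ (1, 0)).comp_left (g := fun t : ℝ => t ^ 2) (by simp)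
  have hint := (hcont.pow 2).integrable_of_hasCompactSupport (μ := volume) hcs
  refine integral_mono_of_nonneg
    (Filter.Eventually.of_forall fun y => integral_nonneg fun x => by positivity)
    (integrable_integral_horn_slice hint).integrableOn ?_
  filter_upwards [ae_restrict_mem measurableSet_Ioi] with y hy
  have hy : 0 < y := hy
  have hderiv : ∀ t, HasDerivAt (fun x => u (x, y)) (fderiv ℝ u (t, y) (1, 0)) t := fun t =>
    ((hu.differentiable (by simp)) (t, y)).hasFDerivAt.comp_hasDerivAt t
      ((hasDerivAt_id t).prodMk (hasDerivAt_const t y))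
  have hle := setIntegral_sq_le_of_eq_zero_right hderiv (hcont.comp (by fun_prop))
    (one_div_pos.2 hy) (hzero (1 / y) y (by field_simp; rfl))
  rw [integral_const_mul]
  calc y ^ 2 * ∫ x in Ioo 0 (1 / y), u (x, y) ^ 2
      ≤ y ^ 2 * ((1 / y) ^ 2 * ∫ x in Ioo 0 (1 / y), fderiv ℝ u (x, y) (1, 0) ^ 2) := by
        gcongr
    _ = ∫ x in Ioo 0 (1 / y), fderiv ℝ u (x, y) (1, 0) ^ 2 := by
        rw [← mul_assoc, ← mul_pow, mul_one_div_cancel hy.ne', one_pow, one_mul]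
end
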